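/- Fix t ∈ (0,1]. For every β ≥ 0, lim_{d→∞} limsup_{n→∞} E[⟨R_{1,2}(σ1,σ2)²⟩_{β/√d, A, A_t}] = 0, where the expectation is over the coupled pair (A, A_t) of sparse disorders with perturbation parameter t, and ⟨·⟩_{β/√d,A,A_t} is the coupled Gibbs average with σ1 ~ μ_{β/√d,A} and σ2 ~ μ_{β/√d,A_t} independent. -/

import Mathlib

open MeasureTheory ProbabilityTheory Filter

noncomputable section

/-- The value of a ±1 spin encoded as a Boolean. -/
def spin (b : Bool) : ℝ := if b then 1 else -1

/-- The Ising Hamiltonian `H(σ; X) = ∑_{i,j} X i j σ(i) σ(j)`. -/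
def Ham {n : ℕ} (X : Fin n → Fin n → ℝ) (σ : Fin n → Bool) : ℝ :=
  ∑ i, ∑ j, X i j * spin (σ i) * spin (σ j)

/-- The partition function `Z(β, X)`. -/
def Zpart {n : ℕ} (β : ℝ) (X : Fin n → Fin n → ℝ) : ℝ :=
  ∑ σ : Fin n → Bool, Real.exp (-β * Ham X σ)

/-- The Gibbs probability mass function `μ_{β,X}(σ)`. -/
def gibbs {n : ℕ} (β : ℝ) (X : Fin n → Fin n → ℝ) (σ : Fin n → Bool) : ℝ :=
  Real.exp (-β * Ham X σ) / Zpart β X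

/-- A configuration is a bisection if `|∑ i σ(i)| ≤ 1`. -/
def isBis {n : ℕ} (σ : Fin n → Bool) : Prop := |∑ i, spin (σ i)| ≤ 1

open scoped Classical in
/-- The bisection partition function `Z^bis(β, X)`. -/
def ZpartBis {n : ℕ} (β : ℝ) (X : Fin n → Fin n → ℝ) : ℝ :=
  ∑ σ : Fin n → Bool, if isBis σ then Real.exp (-β * Ham X σ) else 0

open scoped Classical in
/-- The bisection Gibbs probability mass function `μ^bis_{β,X}(σ)`. -/
def gibbsBis {n : ℕ} (β : ℝ) (X : Fin n → Fin n → ℝ) (σ : Fin n → Bool) : ℝ :=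
  if isBis σ then Real.exp (-β * Ham X σ) / ZpartBis β X else 0

/-- The overlap `R_{1,2}(σ1, σ2) = (1/n) ∑ i σ1(i) σ2(i)`. -/
def overlap {n : ℕ} (σ1 σ2 : Fin n → Bool) : ℝ :=
  (1 / (n : ℝ)) * ∑ i, spin (σ1 i) * spin (σ2 i)

/-- Gibbs average of a one-variable observable. -/
def avg1 {n : ℕ} (β : ℝ) (X : Fin n → Fin n → ℝ) (f : (Fin n → Bool) → ℝ) : ℝ :=
  ∑ σ : Fin n → Bool, f σ * gibbs β X σ

/-- Bisection Gibbs average of a one-variable observable. -/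
def avg1Bis {n : ℕ} (β : ℝ) (X : Fin n → Fin n → ℝ) (f : (Fin n → Bool) → ℝ) : ℝ :=
  ∑ σ : Fin n → Bool, f σ * gibbsBis β X σ

/-- Coupled Gibbs average: `σ1 ~ μ_{β,X}`, `σ2 ~ μ_{β,Y}` independent. -/
def avg2c {n : ℕ} (β : ℝ) (X Y : Fin n → Fin n → ℝ)
    (f : (Fin n → Bool) → (Fin n → Bool) → ℝ) : ℝ :=
  ∑ σ1 : Fin n → Bool, ∑ σ2 : Fin n → Bool, f σ1 σ2 * gibbs β X σ1 * gibbs β Y σ2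

/-- Gibbs average of a two-replica observable. -/
def avg2 {n : ℕ} (β : ℝ) (X : Fin n → Fin n → ℝ)
    (f : (Fin n → Bool) → (Fin n → Bool) → ℝ) : ℝ :=
  avg2c β X X f

/-- Coupled bisection Gibbs average. -/
def avg2cBis {n : ℕ} (β : ℝ) (X Y : Fin n → Fin n → ℝ)
    (f : (Fin n → Bool) → (Fin n → Bool) → ℝ) : ℝ :=
  ∑ σ1 : Fin n → Bool, ∑ σ2 : Fin n → Bool, f σ1 σ2 * gibbsBis β X σ1 * gibbsBis β Y σ2

/-- Bisection Gibbs average of a two-replica observable. -/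
def avg2Bis {n : ℕ} (β : ℝ) (X : Fin n → Fin n → ℝ)
    (f : (Fin n → Bool) → (Fin n → Bool) → ℝ) : ℝ :=
  avg2cBis β X X f

/-- The SK disorder: i.i.d. entries `N(0, 1/(2n))`. -/
def skMeasure (n : ℕ) : Measure (Fin n → Fin n → ℝ) :=
  Measure.pi fun _ => Measure.pi fun _ => gaussianReal 0 (1 / (2 * n))

/-- The law of the pair `(g, g')` of independent SK disorders. -/
def skPair (n : ℕ) : Measure ((Fin n → Fin n → ℝ) × (Fin n → Fin n → ℝ)) :=
  (skMeasure n).prod (skMeasure n)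

/-- The perturbed SK disorder `g_t = √(1-t) g + √t g'`. -/
def skPerturb {n : ℕ} (t : ℝ) (g g' : Fin n → Fin n → ℝ) : Fin n → Fin n → ℝ :=
  fun i j => Real.sqrt (1 - t) * g i j + Real.sqrt t * g' i j

/-- The sparse disorder: i.i.d. entries `Poisson(d/(2n))`. -/
def sparseMeasure (n : ℕ) (d : ℝ) : Measure (Fin n → Fin n → ℕ) :=
  Measure.pi fun _ => Measure.pi fun _ => poissonMeasure (d / (2 * n)).toNNReal

/-- The law of the triple `(A^{(1-t)}, A^{(t,1)}, A^{(t,2)})` of independent sparse disorders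
used to build the coupled pair `A = A^{(1-t)} + A^{(t,1)}`, `A_t = A^{(1-t)} + A^{(t,2)}`. -/
def coupledSparse (n : ℕ) (d t : ℝ) :
    Measure ((Fin n → Fin n → ℕ) × (Fin n → Fin n → ℕ) × (Fin n → Fin n → ℕ)) :=
  (sparseMeasure n ((1 - t) * d)).prod
    ((sparseMeasure n (t * d)).prod (sparseMeasure n (t * d)))

/-- View an ℕ-valued matrix as a real matrix. -/
def natMat {n : ℕ} (A : Fin n → Fin n → ℕ) : Fin n → Fin n → ℝ := fun i j => (A i j : ℝ)

/-- The Gibbs measure `μ_{β,X}` as a probability measure on configurations. -/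
def gibbsMeasure {n : ℕ} (β : ℝ) (X : Fin n → Fin n → ℝ) : Measure (Fin n → Bool) :=
  ∑ σ : Fin n → Bool, ENNReal.ofReal (gibbs β X σ) • Measure.dirac σ

/-- The bisection Gibbs measure `μ^bis_{β,X}` as a measure on configurations. -/
def gibbsBisMeasure {n : ℕ} (β : ℝ) (X : Fin n → Fin n → ℝ) : Measure (Fin n → Bool) :=
  ∑ σ : Fin n → Bool, ENNReal.ofReal (gibbsBis β X σ) • Measure.dirac σ

/-- Normalized Wasserstein distance `W_{2,n}` between measures on `{-1,1}^n`. -/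
def W2 (n : ℕ) (μ1 μ2 : Measure (Fin n → Bool)) : ℝ :=
  sInf {r : ℝ | ∃ π : Measure ((Fin n → Bool) × (Fin n → Bool)),
    IsProbabilityMeasure π ∧ π.map Prod.fst = μ1 ∧ π.map Prod.snd = μ2 ∧
    r = Real.sqrt (∫ p, (1 / (n : ℝ)) * ∑ i, (spin (p.1 i) - spin (p.2 i)) ^ 2 ∂π)}

open scoped Classical in
/-- Overlap-restricted coupled partition function `Z^S_{X,Y}`. -/
def Zres {n : ℕ} (β : ℝ) (S : Set ℝ) (X Y : Fin n → Fin n → ℝ) : ℝ :=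
  ∑ σ1 : Fin n → Bool, ∑ σ2 : Fin n → Bool,
    if overlap σ1 σ2 ∈ S then Real.exp (-β * (Ham X σ1 + Ham Y σ2)) else 0

open scoped Classical in
/-- Overlap-restricted coupled bisection partition function `Z^{S,bis}_{X,Y}`. -/
def ZresBis {n : ℕ} (β : ℝ) (S : Set ℝ) (X Y : Fin n → Fin n → ℝ) : ℝ :=
  ∑ σ1 : Fin n → Bool, ∑ σ2 : Fin n → Bool,
    if isBis σ1 ∧ isBis σ2 ∧ overlap σ1 σ2 ∈ S
    then Real.exp (-β * (Ham X σ1 + Ham Y σ2)) else 0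

/-- The matrix with a single `1` in position `(i,j)`. -/
def Jmat {n : ℕ} (i j : Fin n) : Fin n → Fin n → ℝ :=
  fun a b => if a = i ∧ b = j then 1 else 0

end

/-- Matrices with natural entries, i.e. multigraph adjacency counts. -/
abbrev NatMat (n : ℕ) : Type := Fin n → Fin n → ℕ

instance (n : ℕ) (d : ℝ) : IsProbabilityMeasure (sparseMeasure n d) := by
  unfold sparseMeasure; infer_instance

instance (n : ℕ) (d t : ℝ) : IsProbabilityMeasure (coupledSparse n d t) := by
  unfold coupledSparse; infer_instance

/-- A bounded function on a countable discrete space is integrable for a finite measure. -/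
lemma integrable_of_bounded {α : Type*} [MeasurableSpace α] [DiscreteMeasurableSpace α]
    [Countable α] (μ : Measure α) [IsFiniteMeasure μ] {f : α → ℝ} (C : ℝ) (hf : ∀ x, |f x| ≤ C) :
    Integrable f μ :=
  Integrable.of_bound (Measurable.of_discrete).aestronglyMeasurable C
    (Eventually.of_forall fun x => by simpa using hf x)

/-- The absolute value of an average of a bounded function obeys the same bound. -/
lemma abs_integral_le_of_bounded {α : Type*} [MeasurableSpace α]
    (μ : Measure α) [IsProbabilityMeasure μ] {f : α → ℝ} (C : ℝ) (hf : ∀ x, |f x| ≤ C) :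
    |∫ x, f x ∂μ| ≤ C := by
  have := norm_integral_le_of_norm_le_const (μ := μ) (f := f) (C := C)
    (Eventually.of_forall fun x => by simpa using hf x)
  simpa using this

/-- Coordinatewise sums of independent vectors with independent coordinates. -/
lemma map_add_pi_prod_pi {ι : Type*} [Fintype ι] {E : Type*} [AddCommMonoid E] [MeasurableSpace E]
    [MeasurableAdd₂ E] (μ ν ρ : ι → Measure E) [∀ i, IsProbabilityMeasure (μ i)]
    [∀ i, IsProbabilityMeasure (ν i)] [∀ i, IsProbabilityMeasure (ρ i)]
    (h : ∀ i, ((μ i).prod (ν i)).map (fun p => p.1 + p.2) = ρ i) :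
    ((Measure.pi μ).prod (Measure.pi ν)).map (fun p => p.1 + p.2) = Measure.pi ρ := by
  have key := (measurePreserving_arrowProdEquivProdArrow E E ι μ ν).map_eq
  rw [← key, Measure.map_map (by fun_prop) (MeasurableEquiv.measurable _)]
  have hsf : ∀ i, SigmaFinite (((μ i).prod (ν i)).map (fun p : E × E => p.1 + p.2)) := by
    intro i; rw [h i]; infer_instance
  have := Measure.pi_map_pi (μ := fun i => (μ i).prod (ν i)) (f := fun _ (p : E × E) => p.1 + p.2)
    (fun i => by fun_prop)
  simp_rw [h] at this
  rw [← this]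
  rfl

/-- Sums of independent sparse disorders are sparse disorders. -/
lemma measurePreserving_add_sparse (n : ℕ) {a b : ℝ} (ha : 0 ≤ a) (hb : 0 ≤ b) :
    MeasurePreserving (fun p : NatMat n × NatMat n => p.1 + p.2)
      ((sparseMeasure n a).prod (sparseMeasure n b)) (sparseMeasure n (a + b)) := by
  refine ⟨by fun_prop, ?_⟩
  unfold sparseMeasure
  apply map_add_pi_prod_pi
  intro i
  apply map_add_pi_prod_pi
  intro j
  have := poissonMeasure_conv_poissonMeasure (a / (2 * n)).toNNReal (b / (2 * n)).toNNReal
  rw [Measure.conv, ← Real.toNNReal_add (by positivity) (by positivity), ← add_div] at this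
  exact this

lemma integral_sparse_add (n : ℕ) {a b : ℝ} (ha : 0 ≤ a) (hb : 0 ≤ b) (F : NatMat n → ℝ) :
    ∫ p, F (p.1 + p.2) ∂((sparseMeasure n a).prod (sparseMeasure n b)) =
      ∫ w, F w ∂(sparseMeasure n (a + b)) := by
  rw [← (measurePreserving_add_sparse n ha hb).map_eq,
    integral_map (by fun_prop) Measurable.of_discrete.aestronglyMeasurable]

/-- Independent thinning of the entries of a matrix: each unit of each entry survives with
probability `p`. -/
noncomputable def thin (n : ℕ) (p : unitInterval) : Kernel (NatMat n) (NatMat n) where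
  toFun A := Measure.pi fun i => Measure.pi fun j => binomial (A i j) p
  measurable' := Measurable.of_discrete

lemma thin_apply (n : ℕ) (p : unitInterval) (A : NatMat n) :
    thin n p A = Measure.pi fun i => Measure.pi fun j => binomial (A i j) p := rfl

instance (n : ℕ) (p : unitInterval) : IsMarkovKernel (thin n p) :=
  ⟨fun A => by rw [thin_apply]; infer_instance⟩

/-- The binomial laws form a convolution semigroup. -/
lemma map_add_binomial (a b : ℕ) (p : unitInterval) :
    ((binomial a p).prod (binomial b p)).map (fun x => x.1 + x.2) = binomial (a + b) p := by
  refine Measure.ext_of_singleton fun c => ?_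
  rw [Measure.map_apply (by fun_prop) (measurableSet_singleton c)]
  have hset : (fun x : ℕ × ℕ => x.1 + x.2) ⁻¹' {c} =
      ((Finset.HasAntidiagonal.antidiagonal c : Finset (ℕ × ℕ)) : Set (ℕ × ℕ)) := by
    ext x; simp [Finset.HasAntidiagonal.mem_antidiagonal]
  rw [hset, ← sum_measure_singleton]
  have h1 : ∀ x : ℕ × ℕ, ((binomial a p).prod (binomial b p)) {x} =
      ENNReal.ofReal (((a.choose x.1) * (p : ℝ) ^ x.1 * (1 - p) ^ (a - x.1)) *
        ((b.choose x.2) * (p : ℝ) ^ x.2 * (1 - p) ^ (b - x.2))) := by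
    rintro ⟨k, l⟩
    rw [← Set.singleton_prod_singleton, Measure.prod_prod, binomial_singleton, binomial_singleton,
      ← ENNReal.ofReal_mul binomial_nonneg]
  simp_rw [h1]
  rw [← ENNReal.ofReal_sum_of_nonneg (fun x _ => mul_nonneg binomial_nonneg binomial_nonneg),
    binomial_singleton, Nat.add_choose_eq]
  congr 1
  push_cast
  rw [Finset.sum_mul, Finset.sum_mul]
  refine Finset.sum_congr rfl fun x hx => ?_
  have hx' : x.1 + x.2 = c := by simpa [Finset.HasAntidiagonal.mem_antidiagonal] using hx
  by_cases h1 : x.1 ≤ a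
  · by_cases h2 : x.2 ≤ b
    · have : a + b - c = (a - x.1) + (b - x.2) := by omega
      rw [this, pow_add, ← hx', pow_add]; ring
    · rw [Nat.choose_eq_zero_of_lt (by omega : b < x.2)]; simp
  · rw [Nat.choose_eq_zero_of_lt (by omega : a < x.1)]; simp

lemma map_add_thin (n : ℕ) (p : unitInterval) (A B : NatMat n) :
    ((thin n p A).prod (thin n p B)).map (fun x => x.1 + x.2) = thin n p (A + B) := by
  simp only [thin_apply]
  apply map_add_pi_prod_pi
  intro i
  apply map_add_pi_prod_pi
  intro j
  exact map_add_binomial _ _ _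

lemma poisson_mul_binomial {lam : ℝ} (hlam : 0 ≤ lam) (p : unitInterval) (x y : ℕ) :
    poissonMeasure (lam).toNNReal {x + y} * binomial (x + y) p {x} =
      poissonMeasure (p * lam).toNNReal {x} * poissonMeasure ((1 - p) * lam).toNNReal {y} := by
  have hp0 : (0 : ℝ) ≤ p := p.2.1
  have hp1 : (0 : ℝ) ≤ 1 - p := sub_nonneg.2 p.2.2
  simp only [poissonMeasure_singleton, binomial_singleton]
  rw [← ENNReal.ofReal_mul (by positivity), ← ENNReal.ofReal_mul (by positivity)]
  congr 1
  rw [Real.coe_toNNReal _ hlam, Real.coe_toNNReal _ (by positivity),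
    Real.coe_toNNReal _ (by positivity), Nat.add_sub_cancel_left]
  have hE : Real.exp (-lam) = Real.exp (-(p * lam)) * Real.exp (-((1 - p) * lam)) := by
    rw [← Real.exp_add]; ring_nf
  have hC : ((x + y).choose x : ℝ) = ((x + y).factorial : ℝ) / (x.factorial * y.factorial) := by
    rw [eq_div_iff (by positivity)]
    have := Nat.choose_mul_factorial_mul_factorial (Nat.le_add_right x y)
    rw [Nat.add_sub_cancel_left] at this
    rw [← this]; push_cast; ring
  rw [hE, hC, mul_pow, mul_pow, pow_add]
  field_simp

/-- Thinning a sparse disorder: the joint law of the disorder and its thinned version. -/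
lemma sparse_compProd_thin (n : ℕ) {d : ℝ} (hd : 0 ≤ d) (p : unitInterval) :
    (sparseMeasure n d) ⊗ₘ (thin n p) =
      ((sparseMeasure n (p * d)).prod (sparseMeasure n ((1 - p) * d))).map
        (fun x => (x.1 + x.2, x.1)) := by
  refine Measure.ext_of_singleton fun ac => ?_
  obtain ⟨a, c⟩ := ac
  rw [Measure.map_apply (by fun_prop) (measurableSet_singleton _),
    ← Set.singleton_prod_singleton, Measure.compProd_apply_prod (by simp) (by simp),
    lintegral_singleton]
  by_cases hca : c ≤ a
  · obtain ⟨y, rfl⟩ : ∃ y, a = c + y := ⟨a - c, by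
      funext i j
      have h : c i j ≤ a i j := hca i j
      change a i j = c i j + (a i j - c i j)
      omega⟩
    have hset : (fun x : NatMat n × NatMat n => (x.1 + x.2, x.1)) ⁻¹' ({c + y} ×ˢ {c}) =
        {c} ×ˢ {y} := by
      ext x
      simp only [Set.mem_preimage, Set.mem_prod, Set.mem_singleton_iff]
      constructor
      · rintro ⟨h1, h2⟩; rw [h2] at h1; exact ⟨h2, add_left_cancel h1⟩
      · rintro ⟨h1, h2⟩; rw [h1, h2]; simp
    rw [hset, Measure.prod_prod, mul_comm]
    simp only [sparseMeasure, thin_apply, Measure.pi_singleton, ← Finset.prod_mul_distrib]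
    refine Finset.prod_congr rfl fun i _ => Finset.prod_congr rfl fun j _ => ?_
    have := poisson_mul_binomial (lam := d / (2 * n)) (by positivity) p (c i j) (y i j)
    rw [mul_div_assoc, mul_div_assoc]
    exact this
  · have hset : (fun x : NatMat n × NatMat n => (x.1 + x.2, x.1)) ⁻¹' ({a} ×ˢ {c}) = ∅ := by
      ext x
      simp only [Set.mem_preimage, Set.mem_prod, Set.mem_singleton_iff, Set.mem_empty_iff_false,
        iff_false]
      rintro ⟨h1, h2⟩
      exact hca (by rw [← h1, ← h2]; intro i j; simp)
    rw [hset, measure_empty]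
    obtain ⟨i, hi⟩ := not_forall.1 (show ¬ ∀ i, c i ≤ a i from hca)
    obtain ⟨j, hj⟩ := not_forall.1 (show ¬ ∀ j, c i j ≤ a i j from hi)
    rw [thin_apply, Measure.pi_singleton, Finset.prod_eq_zero (Finset.mem_univ i), zero_mul]
    rw [Measure.pi_singleton, Finset.prod_eq_zero (Finset.mem_univ j)]
    rw [binomial_singleton, Nat.choose_eq_zero_of_lt (by omega)]; simp

/-- Integrals of bounded functions of a disorder and its thinned version. -/
lemma integral_thin (n : ℕ) {d : ℝ} (hd : 0 ≤ d) (p : unitInterval)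
    (F : NatMat n → NatMat n → ℝ) (C : ℝ) (hF : ∀ a c, |F a c| ≤ C) :
    ∫ a, ∫ c, F a c ∂(thin n p a) ∂(sparseMeasure n d) =
      ∫ x, ∫ y, F (x + y) x ∂(sparseMeasure n ((1 - p) * d)) ∂(sparseMeasure n (p * d)) := by
  rw [← Measure.integral_compProd (f := fun z : NatMat n × NatMat n => F z.1 z.2)
      (integrable_of_bounded _ C fun z => hF _ _),
    sparse_compProd_thin n hd p,
    integral_map (by fun_prop) Measurable.of_discrete.aestronglyMeasurable,
    integral_prod _ (integrable_of_bounded _ C fun z => hF _ _)]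

/-- The mean of `f` over a fresh disorder added to `c`. -/
noncomputable def resample (n : ℕ) (d : ℝ) (f : NatMat n → ℝ) (c : NatMat n) : ℝ :=
  ∫ w, f (c + w) ∂(sparseMeasure n d)

/-- The correlation `E[f(A) f(A_t)]` of an observable under the resampling of a fraction
`1 - q` of the disorder. -/
noncomputable def noiseCorr (n : ℕ) (d q : ℝ) (f : NatMat n → ℝ) : ℝ :=
  ∫ c, resample n ((1 - q) * d) f c ^ 2 ∂(sparseMeasure n (q * d))

lemma abs_resample_le {n : ℕ} {d : ℝ} {f : NatMat n → ℝ} {C : ℝ} (hf : ∀ x, |f x| ≤ C)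
    (c : NatMat n) : |resample n d f c| ≤ C :=
  abs_integral_le_of_bounded _ C fun _ => hf _

lemma abs_mul_le_one {a b : ℝ} (ha : |a| ≤ 1) (hb : |b| ≤ 1) : |a * b| ≤ 1 := by
  rw [abs_mul]; exact mul_le_one₀ ha (abs_nonneg _) hb

lemma resample_resample {n : ℕ} {a b : ℝ} (ha : 0 ≤ a) (hb : 0 ≤ b) {f : NatMat n → ℝ} {C : ℝ}
    (hf : ∀ x, |f x| ≤ C) (c : NatMat n) :
    resample n a (resample n b f) c = resample n (a + b) f c := by
  unfold resample
  rw [← integral_sparse_add n ha hb, integral_prod _ (integrable_of_bounded _ C fun _ => hf _)]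
  simp only [add_assoc]

/-- The thinned average of an observable. -/
noncomputable def thinAvg (n : ℕ) (p : unitInterval) (g : NatMat n → ℝ) (a : NatMat n) : ℝ :=
  ∫ c, g c ∂(thin n p a)

lemma abs_thinAvg_le {n : ℕ} {p : unitInterval} {g : NatMat n → ℝ} {C : ℝ} (hg : ∀ x, |g x| ≤ C)
    (a : NatMat n) : |thinAvg n p g a| ≤ C :=
  abs_integral_le_of_bounded _ C hg

lemma thinAvg_add {n : ℕ} {p : unitInterval} {g : NatMat n → ℝ} {C : ℝ} (hg : ∀ x, |g x| ≤ C)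
    (x y : NatMat n) :
    thinAvg n p g (x + y) = ∫ v, ∫ u, g (u + v) ∂(thin n p x) ∂(thin n p y) := by
  unfold thinAvg
  rw [← map_add_thin, integral_map (by fun_prop) Measurable.of_discrete.aestronglyMeasurable,
    integral_prod_symm _ (integrable_of_bounded _ C fun _ => hg _)]

lemma resample_thinAvg {n : ℕ} {d : ℝ} (hd : 0 ≤ d) {p : unitInterval} {g : NatMat n → ℝ} {C : ℝ}
    (hg : ∀ x, |g x| ≤ C) (x : NatMat n) :
    resample n d (thinAvg n p g) x = thinAvg n p (resample n (p * d) g) x := by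
  have h1 : resample n d (thinAvg n p g) x =
      ∫ y, ∫ v, ∫ u, g (u + v) ∂(thin n p x) ∂(thin n p y) ∂(sparseMeasure n d) := by
    unfold resample
    simp only [thinAvg_add hg]
  rw [h1, integral_thin n hd p (fun _ v => ∫ u, g (u + v) ∂(thin n p x)) C
    (fun _ _ => abs_integral_le_of_bounded _ C fun _ => hg _)]
  simp only [integral_const, probReal_univ, one_smul]
  exact integral_integral_swap (f := fun v u => g (u + v))
    (integrable_of_bounded _ C fun z => hg (z.2 + z.1))

lemma noiseCorr_eq_integral_mul_thinAvg {n : ℕ} {d : ℝ} (hd : 0 ≤ d) (p : unitInterval)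
    {f : NatMat n → ℝ} (hf : ∀ x, |f x| ≤ 1) :
    noiseCorr n d p f =
      ∫ a, f a * thinAvg n p (resample n ((1 - p) * d) f) a ∂(sparseMeasure n d) := by
  set g := resample n ((1 - p) * d) f with hg
  have hg1 : ∀ x, |g x| ≤ 1 := abs_resample_le hf
  have h := integral_thin n hd p (fun a c => f a * g c) 1 fun a c => abs_mul_le_one (hf a) (hg1 c)
  simp only [integral_const_mul, integral_mul_const] at h
  unfold thinAvg noiseCorr
  rw [h]
  refine integral_congr_ae (Eventually.of_forall fun x => ?_)
  change g x ^ 2 = g x * g x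
  ring

lemma integral_thinAvg_sq {n : ℕ} {d : ℝ} (hd : 0 ≤ d) (p : unitInterval)
    {f : NatMat n → ℝ} (hf : ∀ x, |f x| ≤ 1) :
    ∫ a, thinAvg n p (resample n ((1 - p) * d) f) a ^ 2 ∂(sparseMeasure n d) =
      noiseCorr n d ((p : ℝ) ^ 2) f := by
  have hp0 : (0 : ℝ) ≤ p := p.2.1
  have hp1 : (0 : ℝ) ≤ 1 - p := sub_nonneg.2 p.2.2
  set g := resample n ((1 - p) * d) f with hg
  have hg1 : ∀ x, |g x| ≤ 1 := abs_resample_le hf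
  have hT1 : ∀ x, |thinAvg n p g x| ≤ 1 := abs_thinAvg_le hg1
  have h := integral_thin n hd p (fun a c => thinAvg n p g a * g c) 1
    fun a c => abs_mul_le_one (hT1 a) (hg1 c)
  simp only [integral_const_mul, integral_mul_const] at h
  have hL : ∫ a, thinAvg n p g a ^ 2 ∂(sparseMeasure n d) =
      ∫ a, thinAvg n p g a * ∫ c, g c ∂(thin n p a) ∂(sparseMeasure n d) :=
    integral_congr_ae (Eventually.of_forall fun x => sq _)
  rw [hL, h]
  set k := resample n (p * ((1 - p) * d)) g with hk
  have hk1 : ∀ x, |k x| ≤ 1 := abs_resample_le hg1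
  have hR : ∀ x, (∫ y, thinAvg n p g (x + y) ∂(sparseMeasure n ((1 - p) * d))) =
      ∫ c, k c ∂(thin n p x) := fun x => resample_thinAvg (by positivity) hg1 x
  simp only [hR]
  have h2 := integral_thin n (d := p * d) (by positivity) p (fun a c => k c * g a) 1
    fun a c => abs_mul_le_one (hk1 c) (hg1 a)
  simp only [integral_const_mul, integral_mul_const] at h2
  rw [h2]
  unfold noiseCorr
  rw [show (p : ℝ) * (p * d) = p ^ 2 * d by ring]
  refine integral_congr_ae (Eventually.of_forall fun x => ?_)
  have e1 : k x = resample n ((1 - (p : ℝ) ^ 2) * d) f x := by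
    rw [hk, hg, resample_resample (by positivity) (by positivity) hf]
    congr 1; ring
  have e2 : (∫ y, g (x + y) ∂(sparseMeasure n ((1 - p) * (p * d)))) = k x := by
    rw [hk, show (1 - (p : ℝ)) * (p * d) = p * ((1 - p) * d) by ring]; rfl
  change k x * (∫ y, g (x + y) ∂(sparseMeasure n ((1 - p) * (p * d)))) = _
  rw [e2, e1]; ring

/-- Linearised midpoint log-convexity of the noise correlation. -/
lemma noiseCorr_le {n : ℕ} {d : ℝ} (hd : 0 ≤ d) {q : ℝ} (hq0 : 0 ≤ q) (hq1 : q ≤ 1)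
    {f : NatMat n → ℝ} (hf : ∀ x, |f x| ≤ 1) {s : ℝ} (hs : 0 < s) :
    noiseCorr n d q f ≤ s / 2 + noiseCorr n d (q ^ 2) f / (2 * s) := by
  let p : unitInterval := ⟨q, hq0, hq1⟩
  have hpq : (p : ℝ) = q := rfl
  rw [← hpq, noiseCorr_eq_integral_mul_thinAvg hd p hf, ← integral_thinAvg_sq hd p hf]
  set T := thinAvg n p (resample n ((1 - p) * d) f) with hT
  have hT1 : ∀ x, |T x| ≤ 1 := abs_thinAvg_le (abs_resample_le hf)
  have hT2 : ∀ x, |T x ^ 2| ≤ 1 := fun x => by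
    rw [sq]; exact abs_mul_le_one (hT1 x) (hT1 x)
  have hi : Integrable (fun a => T a ^ 2) (sparseMeasure n d) := integrable_of_bounded _ 1 hT2
  have hrw : s / 2 + (∫ a, T a ^ 2 ∂(sparseMeasure n d)) / (2 * s) =
      ∫ a, (s / 2 + T a ^ 2 / (2 * s)) ∂(sparseMeasure n d) := by
    rw [integral_add (integrable_const _) (hi.div_const _)]
    simp [integral_div]
  rw [hrw]
  refine integral_mono (integrable_of_bounded _ 1 fun a => abs_mul_le_one (hf a) (hT1 a))
    ((integrable_const _).add (hi.div_const _)) fun a => ?_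
  have hf2 : f a ^ 2 ≤ 1 := by
    have := hf a
    rw [← sq_abs]; nlinarith [abs_nonneg (f a)]
  have : s / 2 + T a ^ 2 / (2 * s) - f a * T a =
      (s * f a - T a) ^ 2 / (2 * s) + s / 2 * (1 - f a ^ 2) := by
    field_simp; ring
  have h0 : 0 ≤ (s * f a - T a) ^ 2 / (2 * s) := by positivity
  have h1 : 0 ≤ s / 2 * (1 - f a ^ 2) := mul_nonneg (by positivity) (by linarith)
  show f a * T a ≤ s / 2 + T a ^ 2 / (2 * s)
  linarith

/-- The averaged squared overlap of the coupled system sharing a fraction `q` of the disorder. -/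
noncomputable def overlapMean (n : ℕ) (b d q : ℝ) : ℝ :=
  ∫ w, avg2c b (natMat (w.1 + w.2.1)) (natMat (w.1 + w.2.2))
    (fun σ1 σ2 => (overlap σ1 σ2) ^ 2) ∂(coupledSparse n d (1 - q))

/-- The two-point function of the Gibbs measure. -/
noncomputable def twoPoint {n : ℕ} (b : ℝ) (i j : Fin n) (A : NatMat n) : ℝ :=
  avg1 b (natMat A) fun σ => spin (σ i) * spin (σ j)

lemma spin_sq (b : Bool) : spin b * spin b = 1 := by cases b <;> simp [spin]

lemma abs_spin (b : Bool) : |spin b| = 1 := by cases b <;> simp [spin]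

lemma Zpart_pos {n : ℕ} (b : ℝ) (X : Fin n → Fin n → ℝ) : 0 < Zpart b X :=
  Finset.sum_pos (fun _ _ => Real.exp_pos _) Finset.univ_nonempty

lemma gibbs_nonneg {n : ℕ} (b : ℝ) (X : Fin n → Fin n → ℝ) (σ : Fin n → Bool) :
    0 ≤ gibbs b X σ := div_nonneg (Real.exp_pos _).le (Zpart_pos b X).le

lemma sum_gibbs {n : ℕ} (b : ℝ) (X : Fin n → Fin n → ℝ) : ∑ σ, gibbs b X σ = 1 := by
  unfold gibbs
  rw [← Finset.sum_div]
  exact div_self (Zpart_pos b X).ne'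

lemma abs_twoPoint_le {n : ℕ} (b : ℝ) (i j : Fin n) (A : NatMat n) : |twoPoint b i j A| ≤ 1 := by
  unfold twoPoint avg1
  refine (Finset.abs_sum_le_sum_abs _ _).trans ?_
  rw [← sum_gibbs b (natMat A)]
  refine Finset.sum_le_sum fun σ _ => ?_
  rw [abs_mul, abs_mul, abs_spin, abs_spin, abs_of_nonneg (gibbs_nonneg _ _ _)]
  simp

lemma overlap_sq {n : ℕ} (σ τ : Fin n → Bool) :
    overlap σ τ ^ 2 = (1 / (n : ℝ) ^ 2) *
      ∑ i, ∑ j, (spin (σ i) * spin (σ j)) * (spin (τ i) * spin (τ j)) := by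
  unfold overlap
  rw [mul_pow, sq (∑ i, spin (σ i) * spin (τ i)), Finset.sum_mul_sum, one_div_pow]
  congr 1
  refine Finset.sum_congr rfl fun i _ => Finset.sum_congr rfl fun j _ => ?_
  ring

lemma avg2c_overlap_sq {n : ℕ} (b : ℝ) (A B : NatMat n) :
    avg2c b (natMat A) (natMat B) (fun σ1 σ2 => overlap σ1 σ2 ^ 2) =
      (1 / (n : ℝ) ^ 2) * ∑ i, ∑ j, twoPoint b i j A * twoPoint b i j B := by
  unfold avg2c twoPoint avg1
  simp only [overlap_sq, Finset.sum_mul_sum]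
  simp only [Finset.mul_sum, Finset.sum_mul]
  rw [Finset.sum_congr rfl fun σ _ => Finset.sum_comm]
  rw [Finset.sum_comm]
  refine Finset.sum_congr rfl fun i _ => ?_
  rw [Finset.sum_congr rfl fun σ _ => Finset.sum_comm]
  rw [Finset.sum_comm]
  refine Finset.sum_congr rfl fun j _ => ?_
  refine Finset.sum_congr rfl fun σ _ => Finset.sum_congr rfl fun τ _ => ?_
  ring

lemma integral_coupledSparse {n : ℕ} {d q : ℝ} {f : NatMat n → ℝ} (hf : ∀ x, |f x| ≤ 1) :
    ∫ w, f (w.1 + w.2.1) * f (w.1 + w.2.2) ∂(coupledSparse n d (1 - q)) = noiseCorr n d q f := by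
  unfold coupledSparse noiseCorr resample
  rw [integral_prod _ (integrable_of_bounded _ 1 fun w => abs_mul_le_one (hf _) (hf _)), sub_sub_cancel]
  refine integral_congr_ae (Eventually.of_forall fun x => ?_)
  simp only
  rw [integral_prod_mul (fun y => f (x + y)) (fun y => f (x + y)), sq]

lemma overlapMean_eq_sum (n : ℕ) (b d q : ℝ) :
    overlapMean n b d q =
      (1 / (n : ℝ) ^ 2) * ∑ i : Fin n, ∑ j : Fin n, noiseCorr n d q (twoPoint b i j) := by
  unfold overlapMean
  simp only [avg2c_overlap_sq]
  have hi : ∀ i j, Integrable (fun w : NatMat n × NatMat n × NatMat n =>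
      twoPoint b i j (w.1 + w.2.1) * twoPoint b i j (w.1 + w.2.2)) (coupledSparse n d (1 - q)) :=
    fun i j => integrable_of_bounded _ 1 fun w =>
      abs_mul_le_one (abs_twoPoint_le _ _ _ _) (abs_twoPoint_le _ _ _ _)
  rw [integral_const_mul, integral_finsetSum _ fun i _ => integrable_finsetSum _ fun j _ => hi i j]
  congr 1
  refine Finset.sum_congr rfl fun i _ => ?_
  rw [integral_finsetSum _ fun j _ => hi i j]
  exact Finset.sum_congr rfl fun j _ => integral_coupledSparse (abs_twoPoint_le b i j)

lemma noiseCorr_nonneg (n : ℕ) (d q : ℝ) (f : NatMat n → ℝ) : 0 ≤ noiseCorr n d q f :=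
  integral_nonneg fun _ => sq_nonneg _

lemma overlapMean_nonneg (n : ℕ) (b d q : ℝ) : 0 ≤ overlapMean n b d q := by
  rw [overlapMean_eq_sum]
  exact mul_nonneg (by positivity)
    (Finset.sum_nonneg fun i _ => Finset.sum_nonneg fun j _ => noiseCorr_nonneg _ _ _ _)

/-- Midpoint log-convexity of the mean squared overlap in the logarithm of the noise. -/
lemma overlapMean_le_sqrt (n : ℕ) (b : ℝ) {d q : ℝ} (hd : 0 ≤ d) (hq0 : 0 ≤ q) (hq1 : q ≤ 1) :
    overlapMean n b d q ≤ Real.sqrt (overlapMean n b d (q ^ 2)) := by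
  have key : ∀ s : ℝ, 0 < s →
      overlapMean n b d q ≤ s / 2 + overlapMean n b d (q ^ 2) / (2 * s) := by
    intro s hs
    rw [overlapMean_eq_sum, overlapMean_eq_sum]
    have h1 : ∑ i : Fin n, ∑ j : Fin n, noiseCorr n d q (twoPoint b i j) ≤
        ∑ i : Fin n, ∑ j : Fin n, (s / 2 + noiseCorr n d (q ^ 2) (twoPoint b i j) / (2 * s)) :=
      Finset.sum_le_sum fun i _ => Finset.sum_le_sum fun j _ =>
        noiseCorr_le hd hq0 hq1 (abs_twoPoint_le b i j) hs
    simp only [Finset.sum_add_distrib, Finset.sum_const, Finset.card_univ, Fintype.card_fin,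
      nsmul_eq_mul, ← Finset.sum_div] at h1
    rcases Nat.eq_zero_or_pos n with rfl | hn
    · simp; positivity
    have hn' : (0 : ℝ) < n := by exact_mod_cast hn
    calc _ ≤ (1 / (n : ℝ) ^ 2) * _ := mul_le_mul_of_nonneg_left h1 (by positivity)
      _ = _ := by field_simp
  set x := overlapMean n b d (q ^ 2) with hx
  have hx0 : 0 ≤ x := overlapMean_nonneg _ _ _ _
  rcases hx0.eq_or_lt with h0 | h0
  · rw [← h0, Real.sqrt_zero]
    refine le_of_forall_pos_le_add fun ε hε => ?_
    have := key ε hε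
    rw [← h0] at this
    simp at this
    linarith
  · have hs := Real.sqrt_pos.2 h0
    have := key _ hs
    have h2 : x / (2 * Real.sqrt x) = Real.sqrt x / 2 := by
      rw [div_eq_div_iff (by positivity) (by positivity)]
      nlinarith [Real.mul_self_sqrt hx0]
    rw [h2] at this
    linarith

lemma overlapMean_le_rpow (n : ℕ) (b : ℝ) {d q : ℝ} (hd : 0 ≤ d) (hq0 : 0 ≤ q) (hq1 : q ≤ 1)
    (k : ℕ) :
    overlapMean n b d q ≤ overlapMean n b d (q ^ 2 ^ k) ^ ((1 / 2 : ℝ) ^ k) := by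
  induction k with
  | zero => simp
  | succ k ih =>
    refine ih.trans ?_
    have h := overlapMean_le_sqrt n b hd (q := q ^ 2 ^ k) (by positivity) (pow_le_one₀ hq0 hq1)
    rw [← pow_mul, ← pow_succ] at h
    calc _ ≤ (Real.sqrt (overlapMean n b d (q ^ 2 ^ (k + 1)))) ^ ((1 / 2 : ℝ) ^ k) :=
          Real.rpow_le_rpow (overlapMean_nonneg _ _ _ _) h (by positivity)
      _ = _ := by
          rw [Real.sqrt_eq_rpow, ← Real.rpow_mul (overlapMean_nonneg _ _ _ _), pow_succ' (1 / 2 : ℝ)]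

section LogSumExp

variable {ι : Type*} [Fintype ι]

/-- The free energy `log ∑ exp u`. -/
noncomputable def logSumExp (u : ι → ℝ) : ℝ := Real.log (∑ i, Real.exp (u i))

/-- The average of `f` for the probability weights proportional to `exp u`. -/
noncomputable def expAvg (u f : ι → ℝ) : ℝ := (∑ i, f i * Real.exp (u i)) / ∑ i, Real.exp (u i)

lemma sum_exp_pos [Nonempty ι] (u : ι → ℝ) : 0 < ∑ i, Real.exp (u i) :=
  Finset.sum_pos (fun _ _ => Real.exp_pos _) Finset.univ_nonempty

lemma sum_mul_exp [Nonempty ι] (u f : ι → ℝ) :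
    ∑ i, f i * Real.exp (u i) = expAvg u f * ∑ i, Real.exp (u i) :=
  (div_mul_cancel₀ _ (sum_exp_pos u).ne').symm

lemma expAvg_mono [Nonempty ι] (u : ι → ℝ) {f g : ι → ℝ} (h : ∀ i, f i ≤ g i) :
    expAvg u f ≤ expAvg u g :=
  div_le_div_of_nonneg_right
    (Finset.sum_le_sum fun i _ => mul_le_mul_of_nonneg_right (h i) (Real.exp_pos _).le)
    (sum_exp_pos u).le

lemma expAvg_const [Nonempty ι] (u : ι → ℝ) (c : ℝ) : expAvg u (fun _ => c) = c := by
  unfold expAvg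
  rw [← Finset.mul_sum]
  exact mul_div_cancel_right₀ _ (sum_exp_pos u).ne'

lemma expAvg_add (u f g : ι → ℝ) : expAvg u (fun i => f i + g i) = expAvg u f + expAvg u g := by
  unfold expAvg
  rw [← add_div, ← Finset.sum_add_distrib]
  simp only [add_mul]

lemma expAvg_const_mul (u f : ι → ℝ) (c : ℝ) :
    expAvg u (fun i => c * f i) = c * expAvg u f := by
  unfold expAvg
  rw [← mul_div_assoc, Finset.mul_sum]
  simp only [mul_assoc]

lemma expAvg_sum {κ : Type*} (s : Finset κ) (u : ι → ℝ) (f : κ → ι → ℝ) :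
    expAvg u (fun i => ∑ k ∈ s, f k i) = ∑ k ∈ s, expAvg u (f k) := by
  unfold expAvg
  rw [← Finset.sum_div, Finset.sum_comm]
  simp only [Finset.sum_mul]

lemma abs_expAvg_le [Nonempty ι] (u : ι → ℝ) {f : ι → ℝ} {c : ℝ} (h : ∀ i, |f i| ≤ c) :
    |expAvg u f| ≤ c := by
  rw [abs_le]
  constructor
  · rw [← expAvg_const u (-c)]; exact expAvg_mono u fun i => (abs_le.1 (h i)).1
  · conv_rhs => rw [← expAvg_const u c]
    exact expAvg_mono u fun i => (abs_le.1 (h i)).2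

lemma logSumExp_add [Nonempty ι] (u f : ι → ℝ) :
    logSumExp (fun i => u i + f i) = logSumExp u + Real.log (expAvg u fun i => Real.exp (f i)) := by
  have h : ∑ i, Real.exp (u i + f i) =
      (∑ i, Real.exp (u i)) * expAvg u (fun i => Real.exp (f i)) := by
    rw [mul_comm, ← sum_mul_exp]
    simp only [Real.exp_add, mul_comm]
  have hp := sum_exp_pos u
  have hq := sum_exp_pos fun i => u i + f i
  unfold logSumExp
  rw [h, Real.log_mul hp.ne']
  intro h0
  rw [h, h0, mul_zero] at hq
  exact hq.false

lemma expAvg_exp_pos [Nonempty ι] (u f : ι → ℝ) : 0 < expAvg u fun i => Real.exp (f i) :=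
  div_pos (Finset.sum_pos (fun _ _ => mul_pos (Real.exp_pos _) (Real.exp_pos _))
    Finset.univ_nonempty) (sum_exp_pos u)

/-- Jensen's inequality for the free energy. -/
lemma logSumExp_add_ge [Nonempty ι] (u f : ι → ℝ) :
    logSumExp u + expAvg u f ≤ logSumExp fun i => u i + f i := by
  rw [logSumExp_add]
  gcongr
  rw [Real.le_log_iff_exp_le (expAvg_exp_pos u f)]
  set m := expAvg u f
  calc Real.exp m = expAvg u fun i => Real.exp m * (1 - m) + Real.exp m * f i := by
        rw [expAvg_add, expAvg_const, expAvg_const_mul]; ring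
    _ ≤ _ := expAvg_mono u fun i => by
        have h := Real.add_one_le_exp (f i - m)
        have : Real.exp (f i) = Real.exp m * Real.exp (f i - m) := by
          rw [← Real.exp_add]; ring_nf
        rw [this]
        nlinarith [Real.exp_pos m]

lemma logSumExp_mono [Nonempty ι] {u v : ι → ℝ} (h : ∀ i, u i ≤ v i) :
    logSumExp u ≤ logSumExp v :=
  Real.log_le_log (sum_exp_pos u) (Finset.sum_le_sum fun i _ => Real.exp_le_exp.2 (h i))

lemma logSumExp_add_const [Nonempty ι] (u : ι → ℝ) (c : ℝ) :
    logSumExp (fun i => u i + c) = logSumExp u + c := by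
  rw [logSumExp_add, expAvg_const, Real.log_exp]

/-- The free energy is 1-Lipschitz for the supremum norm. -/
lemma abs_logSumExp_sub_le [Nonempty ι] {u v : ι → ℝ} {c : ℝ} (h : ∀ i, |v i - u i| ≤ c) :
    |logSumExp v - logSumExp u| ≤ c := by
  rw [abs_le]
  constructor
  · have := logSumExp_mono (u := u) (v := fun i => v i + c) fun i => by
      linarith [(abs_le.1 (h i)).1]
    rw [logSumExp_add_const] at this; linarith
  · have := logSumExp_mono (u := v) (v := fun i => u i + c) fun i => by
      linarith [(abs_le.1 (h i)).2]
    rw [logSumExp_add_const] at this; linarith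

/-- Monotonicity in `U` of the annealed exponents `U⁻¹ log ⟨exp (U f)⟩`. -/
lemma logSumExp_add_le_of_one_le [Nonempty ι] (u f : ι → ℝ) {U : ℝ} (hU : 1 ≤ U) :
    U * (logSumExp (fun i => u i + f i) - logSumExp u) ≤
      logSumExp (fun i => u i + U * f i) - logSumExp u := by
  rw [logSumExp_add, logSumExp_add u (fun i => U * f i)]
  set m := Real.log (expAvg u fun i => Real.exp (f i)) with hm
  have hem : Real.exp m = expAvg u fun i => Real.exp (f i) := Real.exp_log (expAvg_exp_pos u f)
  have hgoal : Real.exp (U * m) ≤ expAvg u fun i => Real.exp (U * f i) := by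
    calc Real.exp (U * m) = expAvg u fun i =>
            Real.exp (U * m) * (1 - U) + (Real.exp (U * m) * U * Real.exp (-m)) * Real.exp (f i) := by
          rw [expAvg_add, expAvg_const, expAvg_const_mul, ← hem]
          have : Real.exp (-m) * Real.exp m = 1 := by rw [← Real.exp_add]; simp
          linear_combination (-(Real.exp (U * m) * U)) * this
      _ ≤ _ := expAvg_mono u fun i => by
          have hb := one_add_mul_self_le_rpow_one_add
            (s := Real.exp (f i - m) - 1) (by linarith [Real.exp_pos (f i - m)]) hU
          rw [add_sub_cancel, ← Real.exp_mul] at hb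
          have e1 : Real.exp (U * f i) = Real.exp (U * m) * Real.exp ((f i - m) * U) := by
            rw [← Real.exp_add]; ring_nf
          have e2 : Real.exp (f i - m) = Real.exp (-m) * Real.exp (f i) := by
            rw [← Real.exp_add]; ring_nf
          rw [e1]
          rw [e2] at hb
          nlinarith [Real.exp_pos (U * m)]
  have := (Real.le_log_iff_exp_le (expAvg_exp_pos u _)).2 hgoal
  linarith

lemma exp_neg_mul_spin {x : ℝ} (hx : x * x = 1) (b : ℝ) :
    Real.exp (-b * x) = Real.cosh b * (1 - Real.tanh b * x) := by
  have hc : Real.cosh b ≠ 0 := (Real.cosh_pos b).ne'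
  rw [Real.tanh_eq_sinh_div_cosh]
  have hmul : Real.cosh b * (1 - Real.sinh b / Real.cosh b * x) =
      Real.cosh b - Real.sinh b * x := by field_simp
  rw [hmul]
  rcases mul_self_eq_one_iff.1 hx with rfl | rfl
  · simp [Real.cosh_sub_sinh]
  · simp [← Real.cosh_add_sinh]

/-- Elementary form of the second difference bound. -/
lemma log_second_difference_le {T X Y Z : ℝ} (hT0 : 0 ≤ T) (hT : T ≤ 1 / 2) (hX : |X| ≤ 1)
    (hY : |Y| ≤ 1) (hZ : |Z| ≤ 1) (hpos : 0 < 1 - T * X - T * Y + T ^ 2 * Z) :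
    Real.log (1 - T * X - T * Y + T ^ 2 * Z) - Real.log (1 - T * X) - Real.log (1 - T * Y) ≤
      T ^ 2 * (Z - X * Y) + 20 * T ^ 3 := by
  obtain ⟨hX1, hX2⟩ := abs_le.1 hX
  obtain ⟨hY1, hY2⟩ := abs_le.1 hY
  obtain ⟨hZ1, hZ2⟩ := abs_le.1 hZ
  have h1 : 1 / 2 ≤ 1 - T * X := by nlinarith
  have h2 : 1 / 2 ≤ 1 - T * Y := by nlinarith
  have hD : 1 / 4 ≤ (1 - T * X) * (1 - T * Y) := by nlinarith
  have hlog : Real.log (1 - T * X - T * Y + T ^ 2 * Z) - Real.log (1 - T * X) -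
      Real.log (1 - T * Y) =
      Real.log ((1 - T * X - T * Y + T ^ 2 * Z) / ((1 - T * X) * (1 - T * Y))) := by
    rw [Real.log_div hpos.ne' (by positivity), Real.log_mul (by positivity) (by positivity)]
    ring
  rw [hlog]
  refine (Real.log_le_sub_one_of_pos (by positivity)).trans ?_
  set D := (1 - T * X) * (1 - T * Y) with hDdef
  have hXY : |X * Y| ≤ 1 := abs_mul_le_one hX hY
  obtain ⟨hXY1, hXY2⟩ := abs_le.1 hXY
  have hnum : 1 - T * X - T * Y + T ^ 2 * Z = D + T ^ 2 * (Z - X * Y) := by rw [hDdef]; ring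
  have hDpos : 0 < D := by linarith
  rw [hnum, add_div, div_self hDpos.ne', add_sub_cancel_left, div_le_iff₀ hDpos]
  have h1D : |1 - D| ≤ 5 / 2 * T := by
    have e : 1 - D = T * (X + Y - T * (X * Y)) := by rw [hDdef]; ring
    rw [e, abs_mul, abs_of_nonneg hT0, mul_comm]
    refine mul_le_mul_of_nonneg_right ?_ hT0
    rw [abs_le]; constructor <;> nlinarith
  have hZXY : |Z - X * Y| ≤ 2 := by rw [abs_le]; constructor <;> linarith
  have hprod : (Z - X * Y) * (1 - D) ≤ 2 * (5 / 2 * T) := by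
    refine (le_abs_self _).trans ?_
    rw [abs_mul]
    exact mul_le_mul hZXY h1D (abs_nonneg _) (by norm_num)
  have hT2 : 0 ≤ T ^ 2 := sq_nonneg T
  have hT3 : 0 ≤ T ^ 3 := by positivity
  have := mul_le_mul_of_nonneg_left hprod hT2
  nlinarith

/-- Second difference of the free energy in two directions with values in `{-1, 1}`. -/
lemma logSumExp_second_difference_le [Nonempty ι] (u x y : ι → ℝ) (hx : ∀ i, x i * x i = 1)
    (hy : ∀ i, y i * y i = 1) {b : ℝ} (hb0 : 0 ≤ Real.tanh b) (hb : Real.tanh b ≤ 1 / 2) :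
    (logSumExp fun i => u i + -b * (x i + y i)) - (logSumExp fun i => u i + -b * x i) -
        (logSumExp fun i => u i + -b * y i) + logSumExp u ≤
      Real.tanh b ^ 2 * ((expAvg u fun i => x i * y i) - expAvg u x * expAvg u y) +
        20 * Real.tanh b ^ 3 := by
  set T := Real.tanh b with hT
  have hc := Real.cosh_pos b
  have eX : (expAvg u fun i => Real.exp (-b * x i)) = Real.cosh b * (1 - T * expAvg u x) := by
    have : (fun i => Real.exp (-b * x i)) =
        fun i => Real.cosh b * ((1 : ℝ) + (-T) * x i) := by
      funext i; rw [exp_neg_mul_spin (hx i)]; ring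
    rw [this, expAvg_const_mul, expAvg_add, expAvg_const, expAvg_const_mul]; ring
  have eY : (expAvg u fun i => Real.exp (-b * y i)) = Real.cosh b * (1 - T * expAvg u y) := by
    have : (fun i => Real.exp (-b * y i)) =
        fun i => Real.cosh b * ((1 : ℝ) + (-T) * y i) := by
      funext i; rw [exp_neg_mul_spin (hy i)]; ring
    rw [this, expAvg_const_mul, expAvg_add, expAvg_const, expAvg_const_mul]; ring
  have eZ : (expAvg u fun i => Real.exp (-b * (x i + y i))) =
      Real.cosh b ^ 2 * (1 - T * expAvg u x - T * expAvg u y +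
        T ^ 2 * expAvg u fun i => x i * y i) := by
    have : (fun i => Real.exp (-b * (x i + y i))) = fun i => Real.cosh b ^ 2 *
        (((1 : ℝ) + (-T) * x i) + ((-T) * y i + T ^ 2 * (x i * y i))) := by
      funext i
      rw [mul_add, Real.exp_add, exp_neg_mul_spin (hx i), exp_neg_mul_spin (hy i)]; ring
    rw [this, expAvg_const_mul, expAvg_add, expAvg_add, expAvg_add, expAvg_const,
      expAvg_const_mul, expAvg_const_mul, expAvg_const_mul]
    ring
  have habs : ∀ z : ℝ, z * z = 1 → |z| ≤ 1 := fun z hz => by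
    rcases mul_self_eq_one_iff.1 hz with rfl | rfl <;> simp
  have bX : |expAvg u x| ≤ 1 := abs_expAvg_le u fun i => habs _ (hx i)
  have bY : |expAvg u y| ≤ 1 := abs_expAvg_le u fun i => habs _ (hy i)
  have bZ : |expAvg u fun i => x i * y i| ≤ 1 := abs_expAvg_le u fun i => habs _ (by
    rw [mul_mul_mul_comm, hx, hy, one_mul])
  rw [logSumExp_add, logSumExp_add u fun i => -b * x i, logSumExp_add u fun i => -b * y i]
  have pX := expAvg_exp_pos u fun i => -b * x i
  have pY := expAvg_exp_pos u fun i => -b * y i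
  have pZ := expAvg_exp_pos u fun i => -b * (x i + y i)
  rw [eX] at pX ⊢
  rw [eY] at pY ⊢
  rw [eZ] at pZ ⊢
  have qX := (mul_pos_iff_of_pos_left hc).1 pX
  have qY := (mul_pos_iff_of_pos_left hc).1 pY
  have qZ := (mul_pos_iff_of_pos_left (pow_pos hc 2)).1 pZ
  rw [Real.log_mul hc.ne' qX.ne', Real.log_mul hc.ne' qY.ne', Real.log_mul (by positivity) qZ.ne',
    Real.log_pow]
  have := log_second_difference_le hb0 hb bX bY bZ qZ
  push_cast
  linarith

end LogSumExp

lemma tanh_nonneg_of_nonneg {b : ℝ} (hb : 0 ≤ b) : 0 ≤ Real.tanh b := by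
  rw [Real.tanh_eq_sinh_div_cosh]
  exact div_nonneg (Real.sinh_nonneg_iff.2 hb) (Real.cosh_pos b).le

lemma tanh_le_two_mul {b : ℝ} (hb : 0 ≤ b) : Real.tanh b ≤ 2 * b := by
  rw [Real.tanh_eq_sinh_div_cosh, div_le_iff₀ (Real.cosh_pos b), Real.sinh_eq, Real.cosh_eq]
  have h1 := Real.add_one_le_exp (-(2 * b))
  have h2 : Real.exp (-b) = Real.exp b * Real.exp (-(2 * b)) := by
    rw [← Real.exp_add]; ring_nf
  have h3 := Real.exp_pos b
  have h4 := Real.exp_pos (-b)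
  nlinarith [mul_nonneg hb h4.le, mul_nonneg hb h3.le]

/-! ### Moments of Poisson and sparse disorders -/

lemma hasSum_poisson_cast (r : NNReal) :
    HasSum (fun k : ℕ => (Real.exp (-r) * (r : ℝ) ^ k / (k.factorial : ℝ)) * (k : ℝ)) r := by
  rw [← hasSum_nat_add_iff' 1]
  simp only [Finset.range_one, Finset.sum_singleton, Nat.cast_zero, mul_zero, sub_zero]
  have h := (hasSum_one_poissonMeasure r).mul_left (r : ℝ)
  rw [mul_one] at h
  refine h.congr_fun fun k => ?_
  rw [Nat.factorial_succ, pow_succ]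
  push_cast
  field_simp

lemma integrable_cast_poissonMeasure (r : NNReal) :
    Integrable (fun k : ℕ => (k : ℝ)) (poissonMeasure r) := by
  rw [integrable_poissonMeasure_iff]
  refine (hasSum_poisson_cast r).summable.congr fun k => ?_
  simp

lemma integral_cast_poissonMeasure (r : NNReal) :
    ∫ k, (k : ℝ) ∂(poissonMeasure r) = r := by
  rw [integral_poissonMeasure]
  refine Eq.trans ?_ (hasSum_poisson_cast r).tsum_eq
  simp

lemma hasSum_poisson_exp (r : NNReal) (s : ℝ) :
    HasSum (fun k : ℕ => (Real.exp (-r) * (r : ℝ) ^ k / (k.factorial : ℝ)) * Real.exp (s * k))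
      (Real.exp (r * (Real.exp s - 1))) := by
  have h := (NormedSpace.expSeries_div_hasSum_exp (r * Real.exp s : ℝ)).mul_left (Real.exp (-r))
  rw [← congrFun Real.exp_eq_exp_ℝ, ← Real.exp_add] at h
  have e : -(r : ℝ) + r * Real.exp s = r * (Real.exp s - 1) := by ring
  rw [e] at h
  refine h.congr_fun fun k => ?_
  rw [mul_pow, mul_comm s, Real.exp_nat_mul]
  ring

lemma integrable_exp_poissonMeasure (r : NNReal) (s : ℝ) :
    Integrable (fun k : ℕ => Real.exp (s * k)) (poissonMeasure r) := by
  rw [integrable_poissonMeasure_iff]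
  refine (hasSum_poisson_exp r s).summable.congr fun k => ?_
  simp

lemma integral_exp_poissonMeasure (r : NNReal) (s : ℝ) :
    ∫ k : ℕ, Real.exp (s * k) ∂(poissonMeasure r) = Real.exp (r * (Real.exp s - 1)) := by
  rw [integral_poissonMeasure]
  refine Eq.trans ?_ (hasSum_poisson_exp r s).tsum_eq
  simp

/-- The total number of edges. -/
def tot {n : ℕ} (A : NatMat n) : ℝ := ∑ i, ∑ j, (A i j : ℝ)

lemma tot_nonneg {n : ℕ} (A : NatMat n) : 0 ≤ tot A :=
  Finset.sum_nonneg fun _ _ => Finset.sum_nonneg fun _ _ => Nat.cast_nonneg _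

lemma tot_add {n : ℕ} (A B : NatMat n) : tot (A + B) = tot A + tot B := by
  simp [tot, Finset.sum_add_distrib]

lemma measurePreserving_entry (n : ℕ) (d : ℝ) (i j : Fin n) :
    MeasurePreserving (fun A : NatMat n => A i j) (sparseMeasure n d)
      (poissonMeasure (d / (2 * n)).toNNReal) :=
  (measurePreserving_eval (fun _ : Fin n => poissonMeasure (d / (2 * n)).toNNReal) j).comp
    (measurePreserving_eval (fun _ : Fin n => Measure.pi fun _ : Fin n =>
      poissonMeasure (d / (2 * n)).toNNReal) i)

lemma integrable_entry (n : ℕ) (d : ℝ) (i j : Fin n) :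
    Integrable (fun A : NatMat n => (A i j : ℝ)) (sparseMeasure n d) :=
  (measurePreserving_entry n d i j).integrable_comp_of_integrable
    (integrable_cast_poissonMeasure _)

lemma integral_entry (n : ℕ) {d : ℝ} (hd : 0 ≤ d) (i j : Fin n) :
    ∫ A : NatMat n, (A i j : ℝ) ∂(sparseMeasure n d) = d / (2 * n) := by
  have h := integral_cast_poissonMeasure (d / (2 * n)).toNNReal
  rw [← (measurePreserving_entry n d i j).map_eq,
    integral_map (measurePreserving_entry n d i j).measurable.aemeasurable
      Measurable.of_discrete.aestronglyMeasurable, Real.coe_toNNReal _ (by positivity)] at h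
  exact h

lemma integrable_tot (n : ℕ) (d : ℝ) : Integrable tot (sparseMeasure n d) :=
  integrable_finsetSum _ fun i _ => integrable_finsetSum _ fun j _ => integrable_entry n d i j

lemma integral_tot (n : ℕ) {d : ℝ} (hd : 0 ≤ d) :
    ∫ A, tot A ∂(sparseMeasure n d) = (n : ℝ) ^ 2 * (d / (2 * n)) := by
  unfold tot
  rw [integral_finsetSum _ fun i _ => integrable_finsetSum _ fun j _ => integrable_entry n d i j]
  simp_rw [integral_finsetSum _ fun j _ => integrable_entry n d _ j, integral_entry n hd]
  simp; ring

/-- The disorder with a single edge. -/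
def edge {n : ℕ} (e : Fin n × Fin n) : NatMat n := fun i j => if e = (i, j) then 1 else 0

lemma edge_injective {n : ℕ} : Function.Injective (edge (n := n)) := by
  intro e e' h
  have := congrFun (congrFun h e.1) e.2
  simp only [edge, if_true] at this
  by_contra hne
  rw [if_neg (fun h' => hne h'.symm)] at this
  exact one_ne_zero this

lemma tot_eq_sum {n : ℕ} (A : NatMat n) : tot A = ∑ e : Fin n × Fin n, (A e.1 e.2 : ℝ) := by
  rw [tot, Fintype.sum_prod_type]

lemma tot_edge {n : ℕ} (e : Fin n × Fin n) : tot (edge e) = 1 := by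
  rw [tot_eq_sum]; simp [edge]

lemma tot_zero {n : ℕ} : tot (0 : NatMat n) = 0 := by simp [tot]

lemma sparseMeasure_singleton (n : ℕ) {d : ℝ} (hd : 0 ≤ d) (A : NatMat n) :
    (sparseMeasure n d).real {A} = ∏ e : Fin n × Fin n,
      (Real.exp (-(d / (2 * n))) * (d / (2 * n)) ^ (A e.1 e.2) / ((A e.1 e.2).factorial : ℝ)) := by
  unfold sparseMeasure
  rw [measureReal_def, Measure.pi_singleton, ENNReal.toReal_prod, Fintype.prod_prod_type]
  refine Finset.prod_congr rfl fun i _ => ?_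
  rw [Measure.pi_singleton, ENNReal.toReal_prod]
  refine Finset.prod_congr rfl fun j _ => ?_
  rw [← measureReal_def, poissonMeasure_real_singleton, Real.coe_toNNReal _ (by positivity)]

lemma sparseMeasure_singleton_edge (n : ℕ) {d : ℝ} (hd : 0 ≤ d) (e : Fin n × Fin n) :
    (sparseMeasure n d).real {edge e} =
      d / (2 * n) * Real.exp (-((n : ℝ) ^ 2 * (d / (2 * n)))) := by
  rw [sparseMeasure_singleton n hd]
  have : ∀ e' : Fin n × Fin n, Real.exp (-(d / (2 * n))) * (d / (2 * n)) ^ (edge e e'.1 e'.2) /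
      ((edge e e'.1 e'.2).factorial : ℝ) =
      Real.exp (-(d / (2 * n))) * if e = e' then d / (2 * n) else 1 := by
    intro e'; unfold edge; split_ifs <;> simp
  simp_rw [this, Finset.prod_mul_distrib]
  rw [Finset.prod_ite_eq, if_pos (Finset.mem_univ _), Finset.prod_const, ← Real.exp_nat_mul]
  simp only [Finset.card_univ, Fintype.card_prod, Fintype.card_fin]
  rw [mul_comm]
  congr 2
  push_cast; ring

lemma sparseMeasure_singleton_zero (n : ℕ) {d : ℝ} (hd : 0 ≤ d) :
    (sparseMeasure n d).real {0} = Real.exp (-((n : ℝ) ^ 2 * (d / (2 * n)))) := by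
  rw [sparseMeasure_singleton n hd]
  simp only [Pi.zero_apply, pow_zero, mul_one, Nat.factorial_zero, Nat.cast_one, div_one,
    Finset.prod_const, ← Real.exp_nat_mul, Finset.card_univ, Fintype.card_prod, Fintype.card_fin]
  congr 1
  push_cast; ring

/-- First-order expansion of a Poisson average at small intensity `ε`. -/
lemma abs_integral_sub_sum_le {α κ : Type*} [MeasurableSpace α] [DiscreteMeasurableSpace α]
    [Countable α] [Fintype κ] (P : Measure α) [IsProbabilityMeasure P] {G T : α → ℝ} {c ε : ℝ}
    (hc : 0 ≤ c) (hε : 0 ≤ ε) (hG : ∀ a, |G a| ≤ c * T a) (hT : Integrable T P)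
    (hTint : ∫ a, T a ∂P = Fintype.card κ * ε) {pt : κ → α} (hpt : Function.Injective pt)
    (hTpt : ∀ e, T (pt e) = 1)
    (hP : ∀ e, P.real {pt e} = ε * Real.exp (-(Fintype.card κ * ε))) :
    |∫ a, G a ∂P - ε * ∑ e, G (pt e)| ≤ 2 * c * (Fintype.card κ : ℝ) ^ 2 * ε ^ 2 := by
  classical
  set N : ℝ := ((Fintype.card κ : ℕ) : ℝ) with hN
  have hN0 : 0 ≤ N := Nat.cast_nonneg _
  set p := ε * Real.exp (-(N * ε)) with hp
  have hp_le : p ≤ ε := mul_le_of_le_one_right hε (Real.exp_le_one_iff.2 (by nlinarith))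
  have hp_ge : ε - N * ε ^ 2 ≤ p := by
    have := Real.add_one_le_exp (-(N * ε))
    rw [hp]; nlinarith
  have hGi : Integrable G P := (hT.const_mul c).mono' Measurable.of_discrete.aestronglyMeasurable
    (Eventually.of_forall fun a => by simpa using hG a)
  let s : Finset α := Finset.univ.image pt
  have hsum : ∀ F : α → ℝ, Integrable F P → ∫ a in (s : Set α), F a ∂P = p * ∑ e, F (pt e) := by
    intro F hF
    rw [setIntegral_finset _ hF.integrableOn, Finset.sum_image fun _ _ _ _ h => hpt h,
      Finset.mul_sum]
    exact Finset.sum_congr rfl fun e _ => by rw [hP, smul_eq_mul]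
  have hGsplit := integral_add_compl (s := (s : Set α)) s.measurableSet hGi
  have hTsplit := integral_add_compl (s := (s : Set α)) s.measurableSet hT
  rw [hsum G hGi] at hGsplit
  rw [hsum T hT, hTint] at hTsplit
  simp only [hTpt, Finset.sum_const, Finset.card_univ, nsmul_eq_mul, mul_one] at hTsplit
  have hcompl : |∫ a in (s : Set α)ᶜ, G a ∂P| ≤ c * ∫ a in (s : Set α)ᶜ, T a ∂P := by
    rw [← integral_const_mul]
    refine (abs_integral_le_integral_abs).trans ?_
    exact integral_mono hGi.abs.integrableOn (hT.const_mul c).integrableOn hG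
  have hGs : |∑ e, G (pt e)| ≤ c * N := by
    refine (Finset.abs_sum_le_sum_abs _ _).trans ?_
    calc ∑ e, |G (pt e)| ≤ ∑ _e : κ, c := Finset.sum_le_sum fun e _ => by
          simpa [hTpt] using hG (pt e)
      _ = c * N := by simp [hN, mul_comm]
  have hfin : ∫ a, G a ∂P - ε * ∑ e, G (pt e) =
      (∫ a in (s : Set α)ᶜ, G a ∂P) - (ε - p) * ∑ e, G (pt e) := by
    rw [← hGsplit]; ring
  rw [hfin]
  have h1 : |(ε - p) * ∑ e, G (pt e)| ≤ (N * ε ^ 2) * (c * N) := by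
    rw [abs_mul, abs_of_nonneg (by linarith : 0 ≤ ε - p)]
    exact mul_le_mul (by linarith) hGs (abs_nonneg _) (by positivity)
  have h2 : ∫ a in (s : Set α)ᶜ, T a ∂P ≤ N * (N * ε ^ 2) := by
    have : ∫ a in (s : Set α)ᶜ, T a ∂P = N * (ε - p) := by linarith
    rw [this]
    exact mul_le_mul_of_nonneg_left (by linarith) hN0
  have h3 := mul_le_mul_of_nonneg_left h2 hc
  have h4 := abs_sub (∫ a in (s : Set α)ᶜ, G a ∂P) ((ε - p) * ∑ e, G (pt e))
  nlinarith

/-! ### The coupled free energy and its block interpolation -/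

/-- Spin configurations. -/
abbrev Conf (n : ℕ) : Type := Fin n → Bool

lemma Ham_natMat_add {n : ℕ} (A B : NatMat n) (σ : Conf n) :
    Ham (natMat (A + B)) σ = Ham (natMat A) σ + Ham (natMat B) σ := by
  simp only [Ham, natMat, ← Finset.sum_add_distrib]
  refine Finset.sum_congr rfl fun i _ => Finset.sum_congr rfl fun j _ => ?_
  simp only [Pi.add_apply, Nat.cast_add]; ring

lemma Ham_natMat_zero {n : ℕ} (σ : Conf n) : Ham (natMat (0 : NatMat n)) σ = 0 := by
  simp [Ham, natMat]

lemma abs_Ham_natMat_le {n : ℕ} (A : NatMat n) (σ : Conf n) : |Ham (natMat A) σ| ≤ tot A := by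
  unfold Ham tot
  refine (Finset.abs_sum_le_sum_abs _ _).trans (Finset.sum_le_sum fun i _ => ?_)
  refine (Finset.abs_sum_le_sum_abs _ _).trans (Finset.sum_le_sum fun j _ => ?_)
  rw [abs_mul, abs_mul, abs_spin, abs_spin]
  simp [natMat]

lemma Ham_natMat_edge {n : ℕ} (e : Fin n × Fin n) (σ : Conf n) :
    Ham (natMat (edge e)) σ = spin (σ e.1) * spin (σ e.2) := by
  unfold Ham
  rw [← Fintype.sum_prod_type'
    (f := fun i j => natMat (edge e) i j * spin (σ i) * spin (σ j))]
  simp [natMat, edge]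

lemma abs_overlap_le {n : ℕ} (σ τ : Conf n) : |overlap σ τ| ≤ 1 := by
  unfold overlap
  rw [abs_mul, abs_of_nonneg (by positivity)]
  have h : |∑ i, spin (σ i) * spin (τ i)| ≤ n := by
    refine (Finset.abs_sum_le_sum_abs _ _).trans ?_
    simp [abs_mul, abs_spin]
  rcases Nat.eq_zero_or_pos n with rfl | hn
  · simp
  · have hn' : (0 : ℝ) < n := by exact_mod_cast hn
    rw [one_div, inv_mul_le_iff₀ hn']; simpa using h

lemma overlap_sq_le_one {n : ℕ} (σ τ : Conf n) : overlap σ τ ^ 2 ≤ 1 := by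
  rw [sq_le_one_iff_abs_le_one]; exact abs_overlap_le σ τ

/-- The squared overlap of a pair of configurations. -/
noncomputable def ovSq {n : ℕ} (p : Conf n × Conf n) : ℝ := overlap p.1 p.2 ^ 2

/-- The exponent of the coupled Gibbs weight with overlap coupling `lam`. -/
noncomputable def pairExp {n : ℕ} (b lam : ℝ) (X Y : NatMat n) (p : Conf n × Conf n) : ℝ :=
  -b * (Ham (natMat X) p.1 + Ham (natMat Y) p.2) + lam * (n * ovSq p)

/-- The coupled free energy. -/
noncomputable def pairFree {n : ℕ} (b lam : ℝ) (X Y : NatMat n) : ℝ :=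
  logSumExp (pairExp b lam X Y)

/-- The mean squared overlap in the coupled system. -/
noncomputable def pairOv {n : ℕ} (b lam : ℝ) (X Y : NatMat n) : ℝ :=
  expAvg (pairExp b lam X Y) ovSq

lemma pairOv_nonneg {n : ℕ} (b lam : ℝ) (X Y : NatMat n) : 0 ≤ pairOv b lam X Y := by
  rw [← expAvg_const (pairExp b lam X Y) 0]
  exact expAvg_mono _ fun p => sq_nonneg _

lemma pairOv_le_one {n : ℕ} (b lam : ℝ) (X Y : NatMat n) : pairOv b lam X Y ≤ 1 := by
  rw [← expAvg_const (pairExp b lam X Y) 1]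
  exact expAvg_mono _ fun p => overlap_sq_le_one _ _

lemma pairExp_add {n : ℕ} (b lam : ℝ) (X Y u v : NatMat n) (p : Conf n × Conf n) :
    pairExp b lam (X + u) (Y + v) p =
      pairExp b lam X Y p + -b * (Ham (natMat u) p.1 + Ham (natMat v) p.2) := by
  unfold pairExp
  rw [Ham_natMat_add, Ham_natMat_add]; ring

lemma abs_pairFree_add_sub_le {n : ℕ} {b : ℝ} (hb : 0 ≤ b) (lam : ℝ) (X Y u v : NatMat n) :
    |pairFree b lam (X + u) (Y + v) - pairFree b lam X Y| ≤ b * (tot u + tot v) := by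
  refine abs_logSumExp_sub_le fun p => ?_
  rw [pairExp_add, add_sub_cancel_left, abs_mul, abs_neg, abs_of_nonneg hb]
  refine mul_le_mul_of_nonneg_left ((abs_add_le _ _).trans ?_) hb
  exact add_le_add (abs_Ham_natMat_le _ _) (abs_Ham_natMat_le _ _)

lemma pairFree_coupling_ge {n : ℕ} (b lam h : ℝ) (X Y : NatMat n) :
    pairFree b lam X Y + h * (n * pairOv b lam X Y) ≤ pairFree b (lam + h) X Y := by
  have := logSumExp_add_ge (pairExp b lam X Y) fun p => h * (n * ovSq p)
  rw [expAvg_const_mul, expAvg_const_mul] at this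
  refine this.trans_eq ?_
  unfold pairFree
  congr 1
  funext p
  unfold pairExp; ring

lemma eq_zero_of_tot_lt_one {n : ℕ} {A : NatMat n} (h : tot A < 1) : A = 0 := by
  funext i j
  by_contra hne
  have h1 : (1 : ℝ) ≤ A i j := by exact_mod_cast Nat.one_le_iff_ne_zero.2 hne
  have h2 : (A i j : ℝ) ≤ ∑ j, (A i j : ℝ) :=
    Finset.single_le_sum (f := fun j => (A i j : ℝ)) (fun _ _ => Nat.cast_nonneg _)
      (Finset.mem_univ j)
  have h3 : ∑ j, (A i j : ℝ) ≤ tot A :=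
    Finset.single_le_sum (f := fun i => ∑ j, (A i j : ℝ))
      (fun _ _ => Finset.sum_nonneg fun _ _ => Nat.cast_nonneg _) (Finset.mem_univ i)
  linarith

lemma pairOv_add_ge {n : ℕ} (b lam : ℝ) (X Y u v : NatMat n) :
    pairOv b lam X Y - (tot u + tot v) ≤ pairOv b lam (X + u) (Y + v) := by
  by_cases h : tot u + tot v < 1
  · have hu := tot_nonneg u
    have hv := tot_nonneg v
    have hu0 : u = 0 := eq_zero_of_tot_lt_one (by linarith)
    have hv0 : v = 0 := eq_zero_of_tot_lt_one (by linarith)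
    subst hu0 hv0
    simp [tot_zero]
  · have := pairOv_le_one b lam X Y
    have := pairOv_nonneg b lam (X + u) (Y + v)
    linarith

/-- The second difference of the coupled free energy along one edge. -/
lemma pairFree_second_difference_le {n : ℕ} {b : ℝ} (hb0 : 0 ≤ Real.tanh b)
    (hb : Real.tanh b ≤ 1 / 2) (lam : ℝ) (X Y : NatMat n) (e : Fin n × Fin n) :
    pairFree b lam (X + edge e) (Y + edge e) - pairFree b lam (X + edge e) Y -
        pairFree b lam X (Y + edge e) + pairFree b lam X Y ≤
      Real.tanh b ^ 2 *
        (expAvg (pairExp b lam X Y) (fun p => (spin (p.1 e.1) * spin (p.1 e.2)) *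
            (spin (p.2 e.1) * spin (p.2 e.2))) -
          expAvg (pairExp b lam X Y) (fun p => spin (p.1 e.1) * spin (p.1 e.2)) *
          expAvg (pairExp b lam X Y) (fun p => spin (p.2 e.1) * spin (p.2 e.2))) +
        20 * Real.tanh b ^ 3 := by
  have hsq : ∀ s s' : Bool, spin s * spin s' * (spin s * spin s') = 1 := fun s s' => by
    rw [mul_mul_mul_comm, spin_sq, spin_sq, one_mul]
  have h := logSumExp_second_difference_le (pairExp b lam X Y)
    (fun p => spin (p.1 e.1) * spin (p.1 e.2)) (fun p => spin (p.2 e.1) * spin (p.2 e.2))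
    (fun p => hsq _ _) (fun p => hsq _ _) hb0 hb
  have e1 : pairFree b lam (X + edge e) (Y + edge e) = logSumExp fun p => pairExp b lam X Y p +
      -b * (spin (p.1 e.1) * spin (p.1 e.2) + spin (p.2 e.1) * spin (p.2 e.2)) := by
    unfold pairFree; congr 1; funext p
    rw [pairExp_add, Ham_natMat_edge, Ham_natMat_edge]
  have e2 : pairFree b lam (X + edge e) Y = logSumExp fun p => pairExp b lam X Y p +
      -b * (spin (p.1 e.1) * spin (p.1 e.2)) := by
    unfold pairFree; congr 1; funext p
    have := pairExp_add b lam X Y (edge e) 0 p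
    rw [add_zero, Ham_natMat_edge, Ham_natMat_zero, add_zero] at this
    exact this
  have e3 : pairFree b lam X (Y + edge e) = logSumExp fun p => pairExp b lam X Y p +
      -b * (spin (p.2 e.1) * spin (p.2 e.2)) := by
    unfold pairFree; congr 1; funext p
    have := pairExp_add b lam X Y 0 (edge e) p
    rw [add_zero, Ham_natMat_edge, Ham_natMat_zero, zero_add] at this
    exact this
  rw [e1, e2, e3]
  exact h

lemma sum_expAvg_mul_nonneg {n : ℕ} (u : Conf n × Conf n → ℝ) :
    0 ≤ ∑ e : Fin n × Fin n, expAvg u (fun p => spin (p.1 e.1) * spin (p.1 e.2)) *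
      expAvg u (fun p => spin (p.2 e.1) * spin (p.2 e.2)) := by
  have h : ∑ e : Fin n × Fin n, expAvg u (fun p => spin (p.1 e.1) * spin (p.1 e.2)) *
      expAvg u (fun p => spin (p.2 e.1) * spin (p.2 e.2)) =
      expAvg u fun p => expAvg u fun p' => (∑ i, spin (p.1 i) * spin (p'.2 i)) ^ 2 := by
    have hin : ∀ p : Conf n × Conf n,
        (expAvg u fun p' => (∑ i, spin (p.1 i) * spin (p'.2 i)) ^ 2) =
        ∑ e : Fin n × Fin n, expAvg u (fun p => spin (p.2 e.1) * spin (p.2 e.2)) *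
          (spin (p.1 e.1) * spin (p.1 e.2)) := by
      intro p
      have : (fun p' : Conf n × Conf n => (∑ i, spin (p.1 i) * spin (p'.2 i)) ^ 2) =
          fun p' => ∑ e : Fin n × Fin n, (spin (p.1 e.1) * spin (p.1 e.2)) *
            (spin (p'.2 e.1) * spin (p'.2 e.2)) := by
        funext p'
        rw [sq, Finset.sum_mul_sum, Fintype.sum_prod_type]
        refine Finset.sum_congr rfl fun i _ => Finset.sum_congr rfl fun j _ => ?_
        ring
      rw [this, expAvg_sum]
      refine Finset.sum_congr rfl fun e _ => ?_
      rw [expAvg_const_mul, mul_comm]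
    simp_rw [hin]
    rw [expAvg_sum]
    refine Finset.sum_congr rfl fun e _ => ?_
    rw [expAvg_const_mul, mul_comm]
  rw [h, ← expAvg_const u 0]
  refine expAvg_mono u fun p => ?_
  conv_lhs => rw [← expAvg_const u 0]
  exact expAvg_mono u fun p' => sq_nonneg _

lemma sum_expAvg_mul_eq {n : ℕ} (b lam : ℝ) (X Y : NatMat n) :
    ∑ e : Fin n × Fin n, expAvg (pairExp b lam X Y) (fun p =>
      (spin (p.1 e.1) * spin (p.1 e.2)) * (spin (p.2 e.1) * spin (p.2 e.2))) =
      (n : ℝ) ^ 2 * pairOv b lam X Y := by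
  rw [← expAvg_sum, pairOv, ← expAvg_const_mul]
  congr 1
  funext p
  unfold ovSq
  rw [overlap_sq, ← Fintype.sum_prod_type'
    (f := fun i j => spin (p.1 i) * spin (p.1 j) * (spin (p.2 i) * spin (p.2 j)))]
  rcases Nat.eq_zero_or_pos n with rfl | hn
  · simp
  · have hn' : (n : ℝ) ≠ 0 := by exact_mod_cast hn.ne'
    field_simp

/-- The sum over all edges of the second differences. -/
lemma sum_pairFree_second_difference_le {n : ℕ} {b : ℝ} (hb0 : 0 ≤ Real.tanh b)
    (hb : Real.tanh b ≤ 1 / 2) (lam : ℝ) (X Y : NatMat n) :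
    ∑ e : Fin n × Fin n, (pairFree b lam (X + edge e) (Y + edge e) -
        pairFree b lam (X + edge e) Y - pairFree b lam X (Y + edge e) + pairFree b lam X Y) ≤
      (n : ℝ) ^ 2 * (Real.tanh b ^ 2 * pairOv b lam X Y + 20 * Real.tanh b ^ 3) := by
  refine (Finset.sum_le_sum fun e _ => pairFree_second_difference_le hb0 hb lam X Y e).trans ?_
  rw [Finset.sum_add_distrib, ← Finset.mul_sum, Finset.sum_sub_distrib, sum_expAvg_mul_eq]
  have h := sum_expAvg_mul_nonneg (pairExp b lam X Y)
  have hT : 0 ≤ Real.tanh b ^ 2 := sq_nonneg _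
  have hc : ∑ _e : Fin n × Fin n, 20 * Real.tanh b ^ 3 = (n : ℝ) ^ 2 * (20 * Real.tanh b ^ 3) := by
    rw [Finset.sum_const, Finset.card_univ, Fintype.card_prod, Fintype.card_fin, nsmul_eq_mul]
    push_cast; ring
  rw [hc]
  nlinarith [mul_nonneg hT h]

lemma integrable_of_abs_le {α : Type*} [MeasurableSpace α] [DiscreteMeasurableSpace α]
    [Countable α] {μ : Measure α} {f g : α → ℝ} (hg : Integrable g μ) (h : ∀ x, |f x| ≤ g x) :
    Integrable f μ :=
  hg.mono' Measurable.of_discrete.aestronglyMeasurable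
    (Eventually.of_forall fun x => by simpa using h x)

lemma abs_pairFree_add_le {n : ℕ} {b : ℝ} (hb : 0 ≤ b) (lam : ℝ) (X Y u v : NatMat n) :
    |pairFree b lam (X + u) (Y + v)| ≤ |pairFree b lam X Y| + b * (tot u + tot v) := by
  have h1 := abs_pairFree_add_sub_le hb lam X Y u v
  have h2 := abs_sub_abs_le_abs_sub (pairFree b lam (X + u) (Y + v)) (pairFree b lam X Y)
  linarith

lemma integrable_tot_prod (n : ℕ) (d d' : ℝ) :
    Integrable (fun v : NatMat n × NatMat n => tot v.1 + tot v.2)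
      ((sparseMeasure n d).prod (sparseMeasure n d')) :=
  ((integrable_tot n d).comp_fst _).add ((integrable_tot n d').comp_snd _)

lemma integral_tot_prod (n : ℕ) {d : ℝ} (hd : 0 ≤ d) :
    ∫ v : NatMat n × NatMat n, (tot v.1 + tot v.2) ∂((sparseMeasure n d).prod (sparseMeasure n d)) =
      2 * (n : ℝ) ^ 2 * (d / (2 * n)) := by
  rw [integral_add ((integrable_tot n d).comp_fst _) ((integrable_tot n d).comp_snd _),
    integral_fun_fst, integral_fun_snd, integral_tot n hd]
  simp; ring

/-- Replacing a small common block of disorder by two independent blocks, at the price of an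
increase of the overlap coupling. -/
lemma pairFree_block_step {n : ℕ} (hn : 0 < n) {b d δ : ℝ} (hb : 0 ≤ b) (hd : 0 ≤ d) (hδ : 0 ≤ δ)
    (hT : Real.tanh b ≤ 1 / 2) (lam : ℝ) (X Y : NatMat n) :
    ∫ u, pairFree b lam (X + u) (Y + u) ∂(sparseMeasure n (δ * d)) ≤
      (∫ v : NatMat n × NatMat n, pairFree b (lam + Real.tanh b ^ 2 * d / 2 * δ) (X + v.1) (Y + v.2)
        ∂((sparseMeasure n (δ * d)).prod (sparseMeasure n (δ * d)))) +
      δ * (10 * Real.tanh b ^ 3 * d * n) +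
      (3 * b * n ^ 2 * d ^ 2 + Real.tanh b ^ 2 * d ^ 2 * n ^ 2 / 2) * δ ^ 2 := by
  have hn' : (0 : ℝ) < n := by exact_mod_cast hn
  have hT0 : 0 ≤ Real.tanh b := tanh_nonneg_of_nonneg hb
  set T := Real.tanh b with hTdef
  set P := sparseMeasure n (δ * d) with hP
  set ε := δ * d / (2 * n) with hε
  have hε0 : 0 ≤ ε := by positivity
  have hδd : 0 ≤ δ * d := by positivity
  set F := pairFree b lam X Y with hF
  -- the common block
  have h0 := abs_integral_sub_sum_le (κ := Fin n × Fin n) P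
    (G := fun u => pairFree b lam (X + u) (Y + u) - F) (T := tot) (c := 2 * b) (ε := ε)
    (by positivity) hε0
    (fun u => (abs_pairFree_add_sub_le hb lam X Y u u).trans_eq (by ring))
    (integrable_tot n _) (by
      rw [integral_tot n hδd, Fintype.card_prod, Fintype.card_fin]; push_cast; ring)
    (pt := edge) edge_injective tot_edge
    (fun e => by
      rw [sparseMeasure_singleton_edge n hδd]; simp only [Fintype.card_prod, Fintype.card_fin]
      push_cast; rw [← hε, sq])
  -- the independent blocks
  let pt : (Fin n × Fin n) ⊕ (Fin n × Fin n) → NatMat n × NatMat n :=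
    Sum.elim (fun e => (edge e, 0)) (fun e => (0, edge e))
  have hedge0 : ∀ e : Fin n × Fin n, edge e ≠ 0 := fun e h => by
    have := tot_edge e
    rw [h, tot_zero] at this
    exact zero_ne_one this
  have hpt : Function.Injective pt := by
    rintro (e | e) (e' | e') h
    · exact congrArg Sum.inl (edge_injective (Prod.ext_iff.1 h).1)
    · exact absurd (Prod.ext_iff.1 h).1 (hedge0 e)
    · exact absurd (Prod.ext_iff.1 h).2 (hedge0 e)
    · exact congrArg Sum.inr (edge_injective (Prod.ext_iff.1 h).2)
  have hexp : Real.exp (-((n : ℝ) ^ 2 * ε)) * Real.exp (-((n : ℝ) ^ 2 * ε)) =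
      Real.exp (-((n * n + n * n) * ε)) := by
    rw [← Real.exp_add]; ring_nf
  have h1 := abs_integral_sub_sum_le (κ := (Fin n × Fin n) ⊕ (Fin n × Fin n)) (P.prod P)
    (G := fun v => pairFree b lam (X + v.1) (Y + v.2) - F) (T := fun v => tot v.1 + tot v.2)
    (c := b) (ε := ε) hb hε0
    (fun v => abs_pairFree_add_sub_le hb lam X Y v.1 v.2)
    (integrable_tot_prod n _ _) (by
      rw [integral_tot_prod n hδd, Fintype.card_sum, Fintype.card_prod, Fintype.card_fin]
      push_cast; ring)
    (pt := pt) hpt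
    (by rintro (e | e) <;> simp [pt, tot_edge, tot_zero])
    (by
      rintro (e | e) <;>
      · simp only [pt, Sum.elim_inl, Sum.elim_inr, Fintype.card_prod, Fintype.card_fin,
          Fintype.card_sum]
        rw [← Set.singleton_prod_singleton, measureReal_prod_prod,
          sparseMeasure_singleton_edge n hδd, sparseMeasure_singleton_zero n hδd, ← hε]
        push_cast
        rw [← hexp]; ring)
  have iP : Integrable (fun u => pairFree b lam (X + u) (Y + u)) P :=
    integrable_of_abs_le (g := fun u => |F| + b * (tot u + tot u))
      ((integrable_const _).add (((integrable_tot n _).add (integrable_tot n _)).const_mul b))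
      fun u => abs_pairFree_add_le hb lam X Y u u
  have iPP : ∀ lam, Integrable
      (fun v : NatMat n × NatMat n => pairFree b lam (X + v.1) (Y + v.2)) (P.prod P) := fun lam =>
    integrable_of_abs_le (g := fun v => |pairFree b lam X Y| + b * (tot v.1 + tot v.2))
      ((integrable_const _).add ((integrable_tot_prod n _ _).const_mul b))
      fun v => abs_pairFree_add_le hb lam X Y v.1 v.2
  rw [integral_sub iP (integrable_const _)] at h0
  rw [integral_sub (iPP lam) (integrable_const _)] at h1
  simp only [integral_const, probReal_univ, one_smul, Fintype.card_prod, Fintype.card_fin,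
    Fintype.card_sum, Fintype.sum_sum_type, pt, Sum.elim_inl, Sum.elim_inr, add_zero] at h0 h1
  -- raising the coupling
  set κ := T ^ 2 * d / 2 with hκ
  have hκ0 : 0 ≤ κ := by positivity
  have iD : Integrable (fun v : NatMat n × NatMat n => κ * δ * n *
      (pairOv b lam X Y - (tot v.1 + tot v.2))) (P.prod P) :=
    ((integrable_const _).sub (integrable_tot_prod n _ _)).const_mul _
  have h2 : (∫ v : NatMat n × NatMat n, pairFree b lam (X + v.1) (Y + v.2) ∂(P.prod P)) +
      κ * δ * n * (pairOv b lam X Y - 2 * (n : ℝ) ^ 2 * ε) ≤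
      ∫ v : NatMat n × NatMat n, pairFree b (lam + κ * δ) (X + v.1) (Y + v.2) ∂(P.prod P) := by
    have hrw : (∫ v : NatMat n × NatMat n, pairFree b lam (X + v.1) (Y + v.2) ∂(P.prod P)) +
        κ * δ * n * (pairOv b lam X Y - 2 * (n : ℝ) ^ 2 * ε) =
        ∫ v : NatMat n × NatMat n, (pairFree b lam (X + v.1) (Y + v.2) +
          κ * δ * n * (pairOv b lam X Y - (tot v.1 + tot v.2))) ∂(P.prod P) := by
      rw [integral_add (iPP lam) iD,
        integral_const_mul, integral_sub (integrable_const _) (integrable_tot_prod n _ _),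
        integral_tot_prod n hδd]
      simp [hε]
    rw [hrw]
    refine integral_mono ((iPP lam).add iD) (iPP _) fun v => ?_
    have hc := pairFree_coupling_ge b lam (κ * δ) (X + v.1) (Y + v.2)
    have ho := pairOv_add_ge b lam X Y v.1 v.2
    have hk : 0 ≤ κ * δ * n := by positivity
    have := mul_le_mul_of_nonneg_left ho hk
    show pairFree b lam (X + v.1) (Y + v.2) +
          κ * δ * n * (pairOv b lam X Y - (tot v.1 + tot v.2)) ≤ _
    linarith
  have h3 := sum_pairFree_second_difference_le hT0 hT lam X Y
  have h3' := mul_le_mul_of_nonneg_left h3 hε0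
  have hsum : ∑ e : Fin n × Fin n, (pairFree b lam (X + edge e) (Y + edge e) -
        pairFree b lam (X + edge e) Y - pairFree b lam X (Y + edge e) + pairFree b lam X Y) =
      (∑ e : Fin n × Fin n, (pairFree b lam (X + edge e) (Y + edge e) - F)) -
      ((∑ e : Fin n × Fin n, (pairFree b lam (X + edge e) Y - F)) +
      ∑ e : Fin n × Fin n, (pairFree b lam X (Y + edge e) - F)) := by
    rw [← Finset.sum_add_distrib, ← Finset.sum_sub_distrib]
    refine Finset.sum_congr rfl fun e _ => ?_
    ring
  rw [hsum] at h3'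
  have h0' := (abs_le.1 h0).2
  have h1' := (abs_le.1 h1).1
  have hnε : (n : ℝ) * ε = δ * d / 2 := by rw [hε]; field_simp
  have c1 : ε * ((n : ℝ) ^ 2 * (T ^ 2 * pairOv b lam X Y + 20 * T ^ 3)) =
      κ * δ * n * pairOv b lam X Y + δ * (10 * T ^ 3 * d * n) := by
    have : ε * ((n : ℝ) ^ 2 * (T ^ 2 * pairOv b lam X Y + 20 * T ^ 3)) =
      (n * ε) * n * (T ^ 2 * pairOv b lam X Y + 20 * T ^ 3) := by ring
    rw [this, hnε, hκ]; ring
  have c2 : 2 * (2 * b) * (((n * n : ℕ) : ℝ)) ^ 2 * ε ^ 2 +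
      2 * b * (((n * n + n * n : ℕ) : ℝ)) ^ 2 * ε ^ 2 = 3 * b * n ^ 2 * d ^ 2 * δ ^ 2 := by
    push_cast
    have : 2 * (2 * b) * ((n : ℝ) * n) ^ 2 * ε ^ 2 + 2 * b * ((n : ℝ) * n + n * n) ^ 2 * ε ^ 2 =
      12 * b * n ^ 2 * (n * ε) ^ 2 := by ring
    rw [this, hnε]; ring
  have c3 : κ * δ * n * (2 * (n : ℝ) ^ 2 * ε) = T ^ 2 * d ^ 2 * n ^ 2 / 2 * δ ^ 2 := by
    have : κ * δ * n * (2 * (n : ℝ) ^ 2 * ε) = 2 * κ * δ * n ^ 2 * (n * ε) := by ring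
    rw [this, hnε, hκ]; ring
  rw [c1] at h3'
  linarith

lemma measurePreserving_of_equiv {α β : Type*} [MeasurableSpace α] [MeasurableSpace β]
    [DiscreteMeasurableSpace α] [DiscreteMeasurableSpace β] [Countable β] (e : α ≃ β)
    {μ : Measure α} {ν : Measure β} (h : ∀ a, μ {a} = ν {e a}) : MeasurePreserving e μ ν := by
  refine ⟨Measurable.of_discrete, Measure.ext_of_singleton fun c => ?_⟩
  rw [Measure.map_apply Measurable.of_discrete (measurableSet_singleton c)]
  have : e ⁻¹' {c} = {e.symm c} := by
    ext x; simp [Equiv.eq_symm_apply]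
  rw [this, h, e.apply_symm_apply]

lemma prod_singleton_eq {α β : Type*} [MeasurableSpace α] [MeasurableSpace β] (μ : Measure α)
    (ν : Measure β) [SFinite μ] [SFinite ν] (p : α × β) :
    (μ.prod ν) {p} = μ {p.1} * ν {p.2} := by
  rw [← Measure.prod_prod, Set.singleton_prod_singleton]

section Shuffles

variable {α β γ δ : Type*} [MeasurableSpace α] [MeasurableSpace β] [MeasurableSpace γ]
  [MeasurableSpace δ] [DiscreteMeasurableSpace α] [DiscreteMeasurableSpace β]
  [DiscreteMeasurableSpace γ] [DiscreteMeasurableSpace δ] [Countable α] [Countable β]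
  [Countable γ] [Countable δ]

lemma measurePreserving_prod_right_comm (μ : Measure α) (ν : Measure β) (ρ : Measure γ)
    [SFinite μ] [SFinite ν] [SFinite ρ] :
    MeasurePreserving (fun x : (α × β) × γ => ((x.1.1, x.2), x.1.2))
      ((μ.prod ν).prod ρ) ((μ.prod ρ).prod ν) :=
  measurePreserving_of_equiv
    (⟨fun x => ((x.1.1, x.2), x.1.2), fun x => ((x.1.1, x.2), x.1.2), fun _ => rfl, fun _ => rfl⟩ :
      (α × β) × γ ≃ (α × γ) × β) fun x => by
    simp only [Equiv.coe_fn_mk, prod_singleton_eq]; ring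

lemma measurePreserving_prod_prod_comm (μ : Measure α) (ν : Measure β) (ρ : Measure γ)
    (θ : Measure δ) [SFinite μ] [SFinite ν] [SFinite ρ] [SFinite θ] :
    MeasurePreserving (fun x : (α × β) × γ × δ => ((x.1.1, x.2.1), (x.1.2, x.2.2)))
      ((μ.prod ν).prod (ρ.prod θ)) ((μ.prod ρ).prod (ν.prod θ)) :=
  measurePreserving_of_equiv
    (⟨fun x => ((x.1.1, x.2.1), (x.1.2, x.2.2)), fun x => ((x.1.1, x.2.1), (x.1.2, x.2.2)),
      fun _ => rfl, fun _ => rfl⟩ : (α × β) × γ × δ ≃ (α × γ) × β × δ) fun x => by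
    simp only [Equiv.coe_fn_mk, prod_singleton_eq]; ring

lemma measurePreserving_prod_assoc_discrete (μ : Measure α) (ν : Measure β) (ρ : Measure γ)
    [SFinite μ] [SFinite ν] [SFinite ρ] :
    MeasurePreserving (fun x : (α × β) × γ => (x.1.1, x.1.2, x.2))
      ((μ.prod ν).prod ρ) (μ.prod (ν.prod ρ)) :=
  measurePreserving_of_equiv (Equiv.prodAssoc α β γ) fun x => by
    simp only [Equiv.prodAssoc_apply, prod_singleton_eq]; ring

end Shuffles

lemma measurePreserving_common_block (n : ℕ) {d q δ : ℝ} (hd : 0 ≤ d) (hq : 0 ≤ q) (hδ : 0 ≤ δ) :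
    MeasurePreserving (fun x : (NatMat n × NatMat n × NatMat n) × NatMat n => (x.1.1 + x.2, x.1.2))
      (((sparseMeasure n (q * d)).prod ((sparseMeasure n ((1 - q - δ) * d)).prod
        (sparseMeasure n ((1 - q - δ) * d)))).prod (sparseMeasure n (δ * d)))
      (coupledSparse n d (1 - (q + δ))) := by
  have h1 := measurePreserving_prod_right_comm (sparseMeasure n (q * d))
    ((sparseMeasure n ((1 - q - δ) * d)).prod (sparseMeasure n ((1 - q - δ) * d)))
    (sparseMeasure n (δ * d))
  have h2 := (measurePreserving_add_sparse n (a := q * d) (b := δ * d) (by positivity)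
    (by positivity)).prod (MeasurePreserving.id ((sparseMeasure n ((1 - q - δ) * d)).prod
      (sparseMeasure n ((1 - q - δ) * d))))
  have h := h2.comp h1
  unfold coupledSparse
  rw [sub_sub_cancel, ← sub_sub, add_mul]
  exact h

lemma measurePreserving_separate_blocks (n : ℕ) {d q δ : ℝ} (hd : 0 ≤ d) (hδ : 0 ≤ δ)
    (hqδ : q + δ ≤ 1) :
    MeasurePreserving (fun x : (NatMat n × NatMat n × NatMat n) × NatMat n × NatMat n =>
        (x.1.1, x.1.2.1 + x.2.1, x.1.2.2 + x.2.2))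
      (((sparseMeasure n (q * d)).prod ((sparseMeasure n ((1 - q - δ) * d)).prod
        (sparseMeasure n ((1 - q - δ) * d)))).prod
        ((sparseMeasure n (δ * d)).prod (sparseMeasure n (δ * d))))
      (coupledSparse n d (1 - q)) := by
  have hr : 0 ≤ 1 - q - δ := by linarith
  have h1 := measurePreserving_prod_assoc_discrete (sparseMeasure n (q * d))
    ((sparseMeasure n ((1 - q - δ) * d)).prod (sparseMeasure n ((1 - q - δ) * d)))
    ((sparseMeasure n (δ * d)).prod (sparseMeasure n (δ * d)))
  have h2 := measurePreserving_prod_prod_comm (sparseMeasure n ((1 - q - δ) * d))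
    (sparseMeasure n ((1 - q - δ) * d)) (sparseMeasure n (δ * d)) (sparseMeasure n (δ * d))
  have h3 := measurePreserving_add_sparse n (a := (1 - q - δ) * d) (b := δ * d) (by positivity)
    (by positivity)
  have h := ((MeasurePreserving.id (sparseMeasure n (q * d))).prod ((h3.prod h3).comp h2)).comp h1
  unfold coupledSparse
  rw [sub_sub_cancel, show (1 - q) * d = (1 - q - δ) * d + δ * d by ring]
  exact h

lemma integrable_pairFree_coupledSparse {n : ℕ} {b : ℝ} (hb : 0 ≤ b) (d lam t : ℝ) :
    Integrable (fun w : NatMat n × NatMat n × NatMat n =>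
      pairFree b lam (w.1 + w.2.1) (w.1 + w.2.2)) (coupledSparse n d t) := by
  unfold coupledSparse
  have i0 := (integrable_tot n ((1 - t) * d)).comp_fst
    ((sparseMeasure n (t * d)).prod (sparseMeasure n (t * d)))
  have i1 := (integrable_tot_prod n (t * d) (t * d)).comp_snd (sparseMeasure n ((1 - t) * d))
  refine integrable_of_abs_le (g := fun w => |pairFree b lam (0 : NatMat n) 0| +
    b * (2 * tot w.1 + (tot w.2.1 + tot w.2.2)))
    ((integrable_const _).add (((i0.const_mul 2).add i1).const_mul b)) fun w => ?_
  have h := abs_pairFree_add_le hb lam 0 0 (w.1 + w.2.1) (w.1 + w.2.2)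
  rw [zero_add, zero_add, tot_add, tot_add] at h
  linarith

/-- The interpolating free energy: a fraction `q` of the disorder is shared and the overlap
coupling decreases linearly in `q`. -/
noncomputable def interpFree (n : ℕ) (b d lam q : ℝ) : ℝ :=
  ∫ w, pairFree b (lam - Real.tanh b ^ 2 * d / 2 * q) (w.1 + w.2.1) (w.1 + w.2.2)
    ∂(coupledSparse n d (1 - q))

lemma interpFree_step {n : ℕ} (hn : 0 < n) {b d q δ : ℝ} (hb : 0 ≤ b) (hd : 0 ≤ d)
    (hT : Real.tanh b ≤ 1 / 2) (lam : ℝ) (hq : 0 ≤ q) (hδ : 0 ≤ δ) (hqδ : q + δ ≤ 1) :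
    interpFree n b d lam (q + δ) ≤ interpFree n b d lam q + δ * (10 * Real.tanh b ^ 3 * d * n) +
      (3 * b * n ^ 2 * d ^ 2 + Real.tanh b ^ 2 * d ^ 2 * n ^ 2 / 2) * δ ^ 2 := by
  set κ := Real.tanh b ^ 2 * d / 2 with hκ
  set E := δ * (10 * Real.tanh b ^ 3 * d * n) +
      (3 * b * n ^ 2 * d ^ 2 + Real.tanh b ^ 2 * d ^ 2 * n ^ 2 / 2) * δ ^ 2 with hE
  set B := (sparseMeasure n (q * d)).prod ((sparseMeasure n ((1 - q - δ) * d)).prod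
        (sparseMeasure n ((1 - q - δ) * d))) with hB
  set D := sparseMeasure n (δ * d) with hD
  have m1 := measurePreserving_common_block n hd hq hδ
  have m2 := measurePreserving_separate_blocks n hd hδ hqδ
  rw [← hB, ← hD] at m1 m2
  have i1 := m1.integrable_comp_of_integrable
    (integrable_pairFree_coupledSparse hb d (lam - κ * (q + δ)) (1 - (q + δ)))
  have i2 := m2.integrable_comp_of_integrable
    (integrable_pairFree_coupledSparse hb d (lam - κ * q) (1 - q))
  have e1 : interpFree n b d lam (q + δ) = ∫ w, ∫ u, pairFree b (lam - κ * (q + δ))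
      ((w.1 + w.2.1) + u) ((w.1 + w.2.2) + u) ∂D ∂B := by
    unfold interpFree
    rw [← m1.map_eq, integral_map m1.measurable.aemeasurable
      Measurable.of_discrete.aestronglyMeasurable]
    refine (integral_prod _ i1).trans ?_
    simp only [Function.comp_def, add_right_comm]
  have e2 : interpFree n b d lam q = ∫ w, ∫ v : NatMat n × NatMat n, pairFree b (lam - κ * q)
      ((w.1 + w.2.1) + v.1) ((w.1 + w.2.2) + v.2) ∂(D.prod D) ∂B := by
    unfold interpFree
    rw [← m2.map_eq, integral_map m2.measurable.aemeasurable
      Measurable.of_discrete.aestronglyMeasurable]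
    refine (integral_prod _ i2).trans ?_
    simp only [Function.comp_def, add_assoc]
  have j1 : Integrable (fun w : NatMat n × NatMat n × NatMat n => ∫ u,
      pairFree b (lam - κ * (q + δ)) ((w.1 + w.2.1) + u) ((w.1 + w.2.2) + u) ∂D) B := by
    have := i1.integral_prod_left
    simpa only [Function.comp_def, add_right_comm] using this
  have j2 : Integrable (fun w : NatMat n × NatMat n × NatMat n => ∫ v : NatMat n × NatMat n,
      pairFree b (lam - κ * q) ((w.1 + w.2.1) + v.1) ((w.1 + w.2.2) + v.2) ∂(D.prod D)) B := by
    have := i2.integral_prod_left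
    simpa only [Function.comp_def, add_assoc] using this
  rw [e1, e2, add_assoc, ← hE]
  have hrw : (∫ w, ∫ v : NatMat n × NatMat n, pairFree b (lam - κ * q)
      ((w.1 + w.2.1) + v.1) ((w.1 + w.2.2) + v.2) ∂(D.prod D) ∂B) + E =
      ∫ w : NatMat n × NatMat n × NatMat n, ((∫ v : NatMat n × NatMat n, pairFree b (lam - κ * q)
      ((w.1 + w.2.1) + v.1) ((w.1 + w.2.2) + v.2) ∂(D.prod D)) + E) ∂B := by
    rw [integral_add j2 (integrable_const _)]; simp
  rw [hrw]
  refine integral_mono j1 (j2.add (integrable_const _)) fun w => ?_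
  have h := pairFree_block_step hn hb hd hδ hT (lam - κ * (q + δ)) (w.1 + w.2.1) (w.1 + w.2.2)
  rw [show lam - κ * (q + δ) + Real.tanh b ^ 2 * d / 2 * δ = lam - κ * q by rw [hκ]; ring,
    add_assoc, ← hE] at h
  exact h

/-- The interpolation bound between the coupled and the decoupled disorders. -/
lemma interpFree_le {n : ℕ} (hn : 0 < n) {b d q : ℝ} (hb : 0 ≤ b) (hd : 0 ≤ d)
    (hT : Real.tanh b ≤ 1 / 2) (lam : ℝ) (hq : 0 ≤ q) (hq1 : q ≤ 1) :
    interpFree n b d lam q ≤ interpFree n b d lam 0 + q * (10 * Real.tanh b ^ 3 * d * n) := by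
  set K := 10 * Real.tanh b ^ 3 * d * n with hK
  set C := 3 * b * n ^ 2 * d ^ 2 + Real.tanh b ^ 2 * d ^ 2 * n ^ 2 / 2 with hC
  have key : ∀ M : ℕ, 0 < M → interpFree n b d lam q ≤
      interpFree n b d lam 0 + q * K + C * q ^ 2 * (1 / (M : ℝ)) := by
    intro M hM
    have hM' : (0 : ℝ) < M := by exact_mod_cast hM
    set δ := q / M with hδ
    have hδ0 : 0 ≤ δ := by positivity
    have hind : ∀ k : ℕ, k ≤ M → interpFree n b d lam (k * δ) ≤
        interpFree n b d lam 0 + k * (δ * K + C * δ ^ 2) := by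
      intro k
      induction k with
      | zero => intro _; simp
      | succ k ih =>
        intro hk
        have h1 := ih (by omega)
        have hle : ((k : ℝ) + 1) * δ ≤ 1 := by
          have : ((k : ℝ) + 1) ≤ M := by exact_mod_cast hk
          calc ((k : ℝ) + 1) * δ ≤ M * δ := mul_le_mul_of_nonneg_right this hδ0
            _ = q := by rw [hδ]; field_simp
            _ ≤ 1 := hq1
        have h2 := interpFree_step hn hb hd hT lam (q := k * δ) (δ := δ) (by positivity) hδ0
          (by linarith)
        rw [← hK, ← hC] at h2
        push_cast
        rw [show ((k : ℝ) + 1) * δ = k * δ + δ by ring]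
        linarith
    have h := hind M le_rfl
    have e1 : (M : ℝ) * δ = q := by rw [hδ]; field_simp
    have e2 : (M : ℝ) * (δ * K + C * δ ^ 2) = q * K + C * q ^ 2 * (1 / (M : ℝ)) := by
      rw [hδ]; field_simp
    rw [e1, e2] at h
    linarith
  have hlim : Tendsto (fun M : ℕ => interpFree n b d lam 0 + q * K +
      C * q ^ 2 * (1 / ((M : ℝ) + 1))) atTop
      (nhds (interpFree n b d lam 0 + q * K + C * q ^ 2 * 0)) :=
    (tendsto_one_div_add_atTop_nhds_zero_nat.const_mul _).const_add _
  rw [mul_zero, add_zero] at hlim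
  refine ge_of_tendsto' hlim fun M => ?_
  have := key (M + 1) (Nat.succ_pos M)
  push_cast at this
  exact this

lemma factorial_mul_pow_le {k l i : ℕ} (hi : i ≤ l) :
    k.factorial * l.factorial * (k ^ (k + i) * l ^ (l - i)) ≤
      (k + i).factorial * (l - i).factorial * (k ^ k * l ^ l) := by
  have h1 : k.factorial * k ^ i ≤ (k + i).factorial :=
    (Nat.mul_le_mul_left _ (Nat.pow_le_pow_left (Nat.le_succ k) i)).trans
      Nat.factorial_mul_pow_le_factorial
  have h2 : l.factorial ≤ (l - i).factorial * l ^ i := by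
    rw [← Nat.factorial_mul_descFactorial hi]
    exact Nat.mul_le_mul_left _ (Nat.descFactorial_le_pow _ _)
  calc k.factorial * l.factorial * (k ^ (k + i) * l ^ (l - i))
      = (k.factorial * k ^ i) * l.factorial * (k ^ k * l ^ (l - i)) := by ring
    _ ≤ (k + i).factorial * ((l - i).factorial * l ^ i) * (k ^ k * l ^ (l - i)) := by gcongr
    _ = (k + i).factorial * (l - i).factorial * (k ^ k * (l ^ (l - i) * l ^ i)) := by ring
    _ = _ := by rw [← pow_add, Nat.sub_add_cancel hi]

/-- The mode of the binomial distribution with success probability `k / (k + l)` is `k`. -/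
lemma choose_mul_pow_le_mode {k l j : ℕ} (hj : j ≤ k + l) :
    k ^ j * l ^ (k + l - j) * (k + l).choose j ≤ k ^ k * l ^ l * (k + l).choose k := by
  have h : k.factorial * l.factorial * (k ^ j * l ^ (k + l - j)) ≤
      j.factorial * (k + l - j).factorial * (k ^ k * l ^ l) := by
    rcases le_total k j with hkj | hkj
    · obtain ⟨i, rfl⟩ := Nat.exists_eq_add_of_le hkj
      have := factorial_mul_pow_le (k := k) (l := l) (i := i) (by omega)
      rwa [show k + l - (k + i) = l - i by omega]
    · obtain ⟨i, rfl⟩ := Nat.exists_eq_add_of_le hkj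
      have := factorial_mul_pow_le (k := l) (l := j + i) (i := i) (by omega)
      rw [Nat.add_sub_cancel] at this
      rw [show j + i + l - j = l + i by omega]
      linarith
  have e1 := Nat.choose_mul_factorial_mul_factorial hj
  have e2 := Nat.choose_mul_factorial_mul_factorial (Nat.le_add_right k l)
  rw [Nat.add_sub_cancel_left] at e2
  have hpos : 0 < k.factorial * l.factorial * (j.factorial * (k + l - j).factorial) := by positivity
  refine Nat.le_of_mul_le_mul_left ?_ hpos
  calc k.factorial * l.factorial * (j.factorial * (k + l - j).factorial) *
        (k ^ j * l ^ (k + l - j) * (k + l).choose j)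
      = ((k + l).choose j * j.factorial * (k + l - j).factorial) *
        (k.factorial * l.factorial * (k ^ j * l ^ (k + l - j))) := by ring
    _ ≤ ((k + l).choose j * j.factorial * (k + l - j).factorial) *
        (j.factorial * (k + l - j).factorial * (k ^ k * l ^ l)) := by gcongr
    _ = ((k + l).choose k * k.factorial * l.factorial) *
        (j.factorial * (k + l - j).factorial * (k ^ k * l ^ l)) := by rw [e1, e2]
    _ = _ := by ring

lemma pow_self_le_choose_mul (k l : ℕ) :
    (k + l) ^ (k + l) ≤ (k + l + 1) * (k ^ k * l ^ l * (k + l).choose k) := by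
  rw [add_pow]
  refine (Finset.sum_le_card_nsmul _ _ (k ^ k * l ^ l * (k + l).choose k) fun j hj =>
    choose_mul_pow_le_mode (Nat.lt_succ_iff.mp (Finset.mem_range.mp hj))).trans ?_
  simp

lemma two_pow_le_choose_mul_exp {k l : ℕ} (hn : 0 < k + l) :
    (2 : ℝ) ^ (k + l) ≤ ((k + l : ℕ) + 1 : ℝ) * (k + l).choose k *
      Real.exp (((k : ℝ) - l) ^ 2 / (k + l : ℕ)) := by
  set n := k + l with hnd
  have hn' : (0 : ℝ) < n := by exact_mod_cast hn
  have hnr : (n : ℝ) = k + l := by rw [hnd]; push_cast; ring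
  set m : ℝ := ((k : ℝ) - l) / n with hm
  have hk : (k : ℝ) = n / 2 * (1 + m) := by rw [hm]; field_simp; linarith
  have hl : (l : ℝ) = n / 2 * (1 - m) := by rw [hm]; field_simp; linarith
  have hk1 : (k : ℝ) ≤ n / 2 * Real.exp m := by
    rw [hk]; have := Real.add_one_le_exp m; gcongr; linarith
  have hl1 : (l : ℝ) ≤ n / 2 * Real.exp (-m) := by
    rw [hl]; have := Real.add_one_le_exp (-m); gcongr; linarith
  have h : ((k + l : ℕ) : ℝ) ^ (k + l) ≤ ((k + l : ℕ) + 1 : ℝ) *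
      ((k : ℝ) ^ k * (l : ℝ) ^ l * (k + l).choose k) := by
    exact_mod_cast pow_self_le_choose_mul k l
  rw [← hnd] at h
  have h2 : (k : ℝ) ^ k * (l : ℝ) ^ l ≤ (n / 2 : ℝ) ^ n * Real.exp (((k : ℝ) - l) ^ 2 / n) := by
    calc (k : ℝ) ^ k * (l : ℝ) ^ l
        ≤ (n / 2 * Real.exp m) ^ k * (n / 2 * Real.exp (-m)) ^ l := by gcongr
      _ = (n / 2 : ℝ) ^ n * Real.exp (k * m + l * (-m)) := by
          rw [mul_pow, mul_pow, ← Real.exp_nat_mul, ← Real.exp_nat_mul, Real.exp_add, hnd, pow_add]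
          ring
      _ = _ := by
          congr 2
          rw [hm]; ring
  have h3 : (n : ℝ) ^ n ≤ (n / 2 : ℝ) ^ n * (((n : ℝ) + 1) * n.choose k *
      Real.exp (((k : ℝ) - l) ^ 2 / n)) := by
    refine h.trans ?_
    calc ((n : ℝ) + 1) * ((k : ℝ) ^ k * (l : ℝ) ^ l * n.choose k)
        ≤ ((n : ℝ) + 1) * (((n / 2 : ℝ) ^ n * Real.exp (((k : ℝ) - l) ^ 2 / n)) * n.choose k) := by
          gcongr
      _ = _ := by ring
  have h4 : (n : ℝ) ^ n = (n / 2 : ℝ) ^ n * 2 ^ n := by rw [← mul_pow]; congr 1; ring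
  rw [h4] at h3
  exact le_of_mul_le_mul_left h3 (by positivity)

/-- The total magnetization of a configuration. -/
noncomputable def mag {n : ℕ} (σ : Conf n) : ℝ := ∑ i, spin (σ i)

lemma mag_eq_card_sub_card {n : ℕ} (σ : Conf n) :
    mag σ = (Fintype.card {i // σ i = true} : ℝ) - Fintype.card {i // σ i = false} := by
  have h : ∀ i, spin (σ i) = (if σ i = true then (1 : ℝ) else 0) - if σ i = false then 1 else 0 := by
    intro i; cases σ i <;> simp [spin]
  simp only [mag, h, Finset.sum_sub_distrib, Finset.sum_boole, Fintype.card_subtype]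

lemma card_true_add_card_false {n : ℕ} (σ : Conf n) :
    Fintype.card {i // σ i = true} + Fintype.card {i // σ i = false} = n := by
  have h := Fintype.card_subtype_compl (fun i => σ i = true)
  have h2 := Fintype.card_subtype_le (fun i => σ i = true)
  simp only [Bool.not_eq_true, Fintype.card_fin] at h h2
  omega

lemma card_perm_comp_eq_le {n : ℕ} (τ τ' : Conf n) :
    (Finset.univ.filter fun π : Equiv.Perm (Fin n) => τ ∘ π = τ').card ≤
      (Fintype.card {i // τ i = true}).factorial * (Fintype.card {i // τ i = false}).factorial := by
  have hs : Fintype.card {g : Equiv.Perm (Fin n) // τ ∘ g = τ} =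
      (Fintype.card {i // τ i = true}).factorial * (Fintype.card {i // τ i = false}).factorial := by
    rw [DomMulAct.stabilizer_card, Fintype.prod_bool]
  rw [← hs, Fintype.card_subtype]
  by_cases h : ∃ π0 : Equiv.Perm (Fin n), τ ∘ π0 = τ'
  · obtain ⟨π0, h0⟩ := h
    refine Finset.card_le_card_of_injOn (fun π => π * π0⁻¹) (fun π hπ => ?_)
      (fun a _ b _ hab => mul_right_cancel hab)
    have hπ' : τ ∘ π = τ' := by simpa using hπ
    have : τ ∘ (π * π0⁻¹ : Equiv.Perm (Fin n)) = τ := by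
      funext i
      have := congrFun (hπ'.trans h0.symm) (π0⁻¹ i)
      simpa using this
    simpa using this
  · rw [Finset.filter_false_of_mem fun π _ hπ => h ⟨π, hπ⟩]
    simp

/-- Averaging over the permutations of the sites is dominated by averaging over all spins. -/
lemma sum_perm_le {n : ℕ} (hn : 0 < n) (τ : Conf n) {F : Conf n → ℝ} (hF : ∀ σ, 0 ≤ F σ) :
    ∑ π : Equiv.Perm (Fin n), F (τ ∘ π) ≤
      n.factorial * ((n + 1) * Real.exp (mag τ ^ 2 / n) * ((∑ σ, F σ) / 2 ^ n)) := by
  set k := Fintype.card {i // τ i = true} with hk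
  set l := Fintype.card {i // τ i = false} with hl
  have hkl : k + l = n := card_true_add_card_false τ
  have hmag : mag τ = (k : ℝ) - l := mag_eq_card_sub_card τ
  have h1 : ∑ π : Equiv.Perm (Fin n), F (τ ∘ π) =
      ∑ τ' : Conf n, ((Finset.univ.filter fun π : Equiv.Perm (Fin n) => τ ∘ π = τ').card : ℝ) *
        F τ' := by
    rw [← Finset.sum_fiberwise (s := Finset.univ) (g := fun π : Equiv.Perm (Fin n) => τ ∘ π)]
    refine Finset.sum_congr rfl fun τ' _ => ?_
    rw [Finset.sum_congr rfl (g := fun _ => F τ') fun π hπ => by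
      rw [(Finset.mem_filter.mp hπ).2], Finset.sum_const, nsmul_eq_mul]
  have h2 : ((k.factorial : ℝ) * l.factorial) ≤
      n.factorial * ((n + 1) * Real.exp (mag τ ^ 2 / n) / 2 ^ n) := by
    have hc : (n.choose k : ℝ) * k.factorial * l.factorial = n.factorial := by
      have := Nat.choose_mul_factorial_mul_factorial (Nat.le_add_right k l)
      rw [Nat.add_sub_cancel_left, hkl] at this
      exact_mod_cast this
    have hp := two_pow_le_choose_mul_exp (k := k) (l := l) (by omega)
    rw [hkl, ← hmag] at hp
    rw [← mul_div_assoc, le_div_iff₀ (by positivity), ← hc]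
    calc (k.factorial : ℝ) * l.factorial * 2 ^ n
        ≤ (k.factorial : ℝ) * l.factorial *
          (((n : ℝ) + 1) * n.choose k * Real.exp (mag τ ^ 2 / n)) := by gcongr
      _ = _ := by ring
  rw [h1]
  calc ∑ τ' : Conf n, ((Finset.univ.filter fun π : Equiv.Perm (Fin n) => τ ∘ π = τ').card : ℝ) *
        F τ'
      ≤ ∑ τ' : Conf n, ((k.factorial : ℝ) * l.factorial) * F τ' := by
        refine Finset.sum_le_sum fun τ' _ => mul_le_mul_of_nonneg_right ?_ (hF τ')
        exact_mod_cast card_perm_comp_eq_le τ τ'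
    _ = ((k.factorial : ℝ) * l.factorial) * ∑ τ', F τ' := by rw [Finset.mul_sum]
    _ ≤ (n.factorial * ((n + 1) * Real.exp (mag τ ^ 2 / n) / 2 ^ n)) * ∑ τ', F τ' :=
        mul_le_mul_of_nonneg_right h2 (Finset.sum_nonneg fun τ' _ => hF τ')
    _ = _ := by ring

lemma sum_exp_mul_sum_spin (n : ℕ) (σ : Conf n) (θ : ℝ) :
    ∑ τ : Conf n, Real.exp (θ * ∑ i, spin (σ i) * spin (τ i)) = 2 ^ n * Real.cosh θ ^ n := by
  have h : ∀ τ : Conf n, Real.exp (θ * ∑ i, spin (σ i) * spin (τ i)) =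
      ∏ i, Real.exp (θ * (spin (σ i) * spin (τ i))) := fun τ => by
    rw [Finset.mul_sum, Real.exp_sum]
  simp only [h]
  rw [← Fintype.piFinset_univ, ← Finset.prod_univ_sum (fun _ => Finset.univ)
    (fun i c => Real.exp (θ * (spin (σ i) * spin c)))]
  have h2 : ∀ i, ∑ c : Bool, Real.exp (θ * (spin (σ i) * spin c)) = 2 * Real.cosh θ := by
    intro i
    rw [Fintype.sum_bool, Real.cosh_eq]
    cases σ i <;> simp [spin] <;> ring
  simp only [h2, Finset.prod_const, Finset.card_univ, Fintype.card_fin, mul_pow]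

lemma exp_sq_div_le_sum {n : ℕ} (hn : 0 < n) {S : ℤ} (hS : |S| ≤ n) :
    Real.exp ((S : ℝ) ^ 2 / (2 * n)) ≤
      ∑ s ∈ Finset.Icc (-(n : ℤ)) n, Real.exp ((s : ℝ) / n * S - (s : ℝ) ^ 2 / (2 * n)) := by
  have hn' : (0 : ℝ) < n := by exact_mod_cast hn
  have hmem : S ∈ Finset.Icc (-(n : ℤ)) n := Finset.mem_Icc.mpr (abs_le.mp hS)
  refine le_trans (le_of_eq ?_) (Finset.single_le_sum
    (f := fun s : ℤ => Real.exp ((s : ℝ) / n * S - (s : ℝ) ^ 2 / (2 * n)))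
    (fun s _ => (Real.exp_pos _).le) hmem)
  congr 1
  field_simp
  ring

lemma exists_int_sum_spin {n : ℕ} (σ τ : Conf n) :
    ∃ S : ℤ, |S| ≤ n ∧ (S : ℝ) = ∑ i, spin (σ i) * spin (τ i) := by
  refine ⟨∑ i, (if σ i = τ i then 1 else -1), ?_, ?_⟩
  · refine (Finset.abs_sum_le_sum_abs _ _).trans ?_
    refine (Finset.sum_le_card_nsmul _ _ 1 fun i _ => ?_).trans (by simp)
    split_ifs <;> simp
  · push_cast
    refine Finset.sum_congr rfl fun i _ => ?_
    cases σ i <;> cases τ i <;> simp [spin]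

/-- Under the uniform measure the critical exponential moment of the overlap grows at most
linearly. -/
lemma sum_exp_overlap_sq_le {n : ℕ} (hn : 0 < n) (σ : Conf n) :
    ∑ τ : Conf n, Real.exp (1 / 2 * (n * overlap σ τ ^ 2)) ≤ 2 ^ n * (2 * n + 1) := by
  have hn' : (0 : ℝ) < n := by exact_mod_cast hn
  have h1 : ∀ τ : Conf n, Real.exp (1 / 2 * (n * overlap σ τ ^ 2)) ≤
      ∑ s ∈ Finset.Icc (-(n : ℤ)) n, Real.exp (-((s : ℝ) ^ 2 / (2 * n))) *
        Real.exp ((s : ℝ) / n * ∑ i, spin (σ i) * spin (τ i)) := by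
    intro τ
    obtain ⟨S, hS, hSe⟩ := exists_int_sum_spin σ τ
    have h := exp_sq_div_le_sum hn hS
    rw [← hSe]
    have e : 1 / 2 * (n * overlap σ τ ^ 2) = (S : ℝ) ^ 2 / (2 * n) := by
      rw [overlap, ← hSe]; field_simp
    rw [e]
    refine h.trans (le_of_eq (Finset.sum_congr rfl fun s _ => ?_))
    rw [← Real.exp_add]; congr 1; ring
  refine (Finset.sum_le_sum fun τ _ => h1 τ).trans ?_
  rw [Finset.sum_comm]
  have h2 : ∀ s ∈ Finset.Icc (-(n : ℤ)) n, ∑ τ : Conf n, Real.exp (-((s : ℝ) ^ 2 / (2 * n))) *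
        Real.exp ((s : ℝ) / n * ∑ i, spin (σ i) * spin (τ i)) ≤ 2 ^ n := by
    intro s _
    rw [← Finset.mul_sum, sum_exp_mul_sum_spin]
    have hc : Real.cosh ((s : ℝ) / n) ^ n ≤ Real.exp ((s : ℝ) ^ 2 / (2 * n)) := by
      calc Real.cosh ((s : ℝ) / n) ^ n ≤ Real.exp (((s : ℝ) / n) ^ 2 / 2) ^ n :=
            pow_le_pow_left₀ (Real.cosh_pos _).le (Real.cosh_le_exp_half_sq _) n
        _ = _ := by rw [← Real.exp_nat_mul]; congr 1; field_simp
    calc Real.exp (-((s : ℝ) ^ 2 / (2 * n))) * (2 ^ n * Real.cosh ((s : ℝ) / n) ^ n)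
        ≤ Real.exp (-((s : ℝ) ^ 2 / (2 * n))) * (2 ^ n * Real.exp ((s : ℝ) ^ 2 / (2 * n))) := by
          gcongr
      _ = 2 ^ n * (Real.exp (-((s : ℝ) ^ 2 / (2 * n))) * Real.exp ((s : ℝ) ^ 2 / (2 * n))) := by
          ring
      _ = 2 ^ n := by rw [← Real.exp_add]; simp
  refine (Finset.sum_le_card_nsmul _ _ _ h2).trans (le_of_eq ?_)
  rw [Int.card_Icc, nsmul_eq_mul]
  have : ((n : ℤ) + 1 - -(n : ℤ)).toNat = 2 * n + 1 := by omega
  rw [this]; push_cast; ring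

/-- The free energy with a squared-magnetization coupling `u`. -/
noncomputable def magFree {n : ℕ} (b u : ℝ) (A : NatMat n) : ℝ :=
  logSumExp fun τ : Conf n => -b * Ham (natMat A) τ + u * (mag τ ^ 2 / n)

lemma magFree_zero_eq_log_Zpart {n : ℕ} (b : ℝ) (A : NatMat n) :
    magFree b 0 A = Real.log (Zpart b (natMat A)) := by
  simp [magFree, logSumExp, Zpart]

lemma abs_magFree_le {n : ℕ} {b : ℝ} (hb : 0 ≤ b) (u : ℝ) (A : NatMat n) :
    |magFree b u A| ≤ |magFree b u (0 : NatMat n)| + b * tot A := by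
  have h : |magFree b u A - magFree b u (0 : NatMat n)| ≤ b * tot A := by
    refine abs_logSumExp_sub_le fun τ => ?_
    rw [Ham_natMat_zero, show -b * Ham (natMat A) τ + u * (mag τ ^ 2 / n) -
      (-b * 0 + u * (mag τ ^ 2 / n)) = -(b * Ham (natMat A) τ) by ring, abs_neg, abs_mul,
      abs_of_nonneg hb]
    exact mul_le_mul_of_nonneg_left (abs_Ham_natMat_le A τ) hb
  have := abs_sub_abs_le_abs_sub (magFree b u A) (magFree b u (0 : NatMat n))
  linarith

lemma integrable_magFree {n : ℕ} {b : ℝ} (hb : 0 ≤ b) (u d : ℝ) :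
    Integrable (fun A : NatMat n => magFree b u A) (sparseMeasure n d) :=
  integrable_of_abs_le ((integrable_const _).add ((integrable_tot n d).const_mul b))
    (abs_magFree_le hb u)

/-- Relabelling of the sites of a disorder matrix. -/
def permMat {n : ℕ} (π : Equiv.Perm (Fin n)) : NatMat n ≃ NatMat n where
  toFun A := fun i j => A (π i) (π j)
  invFun A := fun i j => A (π.symm i) (π.symm j)
  left_inv A := by simp
  right_inv A := by simp

lemma Ham_permMat {n : ℕ} (π : Equiv.Perm (Fin n)) (A : NatMat n) (τ : Conf n) :
    Ham (natMat (permMat π A)) (τ ∘ π) = Ham (natMat A) τ := by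
  unfold Ham natMat
  rw [← Equiv.sum_comp π (fun i => ∑ j, (A i j : ℝ) * spin (τ i) * spin (τ j))]
  refine Finset.sum_congr rfl fun i _ => ?_
  rw [← Equiv.sum_comp π (fun j => (A (π i) j : ℝ) * spin (τ (π i)) * spin (τ j))]
  rfl

lemma measurePreserving_permMat {n : ℕ} {d : ℝ} (hd : 0 ≤ d) (π : Equiv.Perm (Fin n)) :
    MeasurePreserving (permMat π) (sparseMeasure n d) (sparseMeasure n d) := by
  refine measurePreserving_of_equiv (permMat π) fun A => ?_
  rw [← measureReal_eq_measureReal_iff, sparseMeasure_singleton n hd, sparseMeasure_singleton n hd,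
    ← Equiv.prod_comp (π.prodCongr π)]
  rfl

lemma log_le_div_add {x c : ℝ} (hx : 0 < x) (hc : 0 < c) :
    Real.log x ≤ x / c - 1 + Real.log c := by
  have h := Real.log_le_sub_one_of_pos (div_pos hx hc)
  rw [Real.log_div hx.ne' hc.ne'] at h
  linarith

lemma sum_log_le {κ : Type*} [Fintype κ] {x : κ → ℝ} {c : ℝ} (hx : ∀ k, 0 < x k) (hc : 0 < c)
    (h : ∑ k, x k ≤ Fintype.card κ * c) :
    ∑ k, Real.log (x k) ≤ Fintype.card κ * Real.log c := by
  refine (Finset.sum_le_sum fun k _ => log_le_div_add (hx k) hc).trans ?_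
  rw [Finset.sum_add_distrib, Finset.sum_sub_distrib, ← Finset.sum_div]
  simp only [Finset.sum_const, Finset.card_univ, nsmul_eq_mul, mul_one]
  have : (∑ k, x k) / c ≤ Fintype.card κ := (div_le_iff₀ hc).mpr h
  linarith

lemma integral_log_le {α : Type*} [MeasurableSpace α] (P : Measure α) [IsProbabilityMeasure P]
    {f : α → ℝ} {c : ℝ} (hf : ∀ x, 0 < f x) (hc : 0 < c) (hfi : Integrable f P)
    (hlog : Integrable (fun x => Real.log (f x)) P) (h : ∫ x, f x ∂P ≤ c) :
    ∫ x, Real.log (f x) ∂P ≤ Real.log c := by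
  have hi : Integrable (fun x => f x / c + (Real.log c - 1)) P :=
    (hfi.div_const c).add (integrable_const _)
  refine (integral_mono hlog hi fun x => ?_).trans ?_
  · have := log_le_div_add (hf x) hc
    simp only
    linarith
  · rw [integral_add (hfi.div_const c) (integrable_const _), integral_div]
    have : (∫ x, f x ∂P) / c ≤ 1 := (div_le_one hc).mpr h
    simp only [integral_const, probReal_univ, smul_eq_mul, one_mul]
    linarith

/-- Averaging the second disorder over relabellings decouples the two systems. -/
lemma sum_pairFree_permMat_le {n : ℕ} (hn : 0 < n) (b : ℝ) (X A : NatMat n) :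
    ∑ π : Equiv.Perm (Fin n), pairFree b (1 / 2) X (permMat π A) ≤
      n.factorial * (magFree b 0 X + Real.log ((2 * n + 1) * (n + 1)) + magFree b 1 A) := by
  set F : Conf n → ℝ := fun τ => ∑ σ : Conf n, Real.exp (-b * Ham (natMat X) σ) *
    Real.exp (1 / 2 * (n * overlap σ τ ^ 2)) with hF
  have hFnn : ∀ τ, 0 ≤ F τ := fun τ => Finset.sum_nonneg fun σ _ => by positivity
  set ZX := ∑ σ : Conf n, Real.exp (-b * Ham (natMat X) σ) with hZX
  set M := ∑ τ : Conf n, Real.exp (-b * Ham (natMat A) τ + 1 * (mag τ ^ 2 / n)) with hM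
  have hZpos : 0 < ZX := sum_exp_pos _
  have hMpos : 0 < M := sum_exp_pos _
  have hFsum : (∑ τ, F τ) / 2 ^ n ≤ (2 * n + 1) * ZX := by
    rw [div_le_iff₀ (by positivity), hF, Finset.sum_comm, hZX, Finset.mul_sum, Finset.sum_mul]
    refine Finset.sum_le_sum fun σ _ => ?_
    rw [← Finset.mul_sum]
    calc Real.exp (-b * Ham (natMat X) σ) * ∑ τ, Real.exp (1 / 2 * (n * overlap σ τ ^ 2))
        ≤ Real.exp (-b * Ham (natMat X) σ) * (2 ^ n * (2 * n + 1)) := by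
          gcongr; exact sum_exp_overlap_sq_le hn σ
      _ = _ := by ring
  have hsum : ∀ π : Equiv.Perm (Fin n), ∑ p, Real.exp (pairExp b (1 / 2) X (permMat π A) p) =
      ∑ τ : Conf n, Real.exp (-b * Ham (natMat A) τ) * F (τ ∘ π) := by
    intro π
    rw [Fintype.sum_prod_type_right, ← Equiv.sum_comp (π.symm.arrowCongr (Equiv.refl Bool))]
    refine Finset.sum_congr rfl fun τ _ => ?_
    have e : π.symm.arrowCongr (Equiv.refl Bool) τ = τ ∘ π := rfl
    rw [e, hF, Finset.mul_sum]
    refine Finset.sum_congr rfl fun σ _ => ?_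
    rw [← Real.exp_add, ← Real.exp_add, pairExp, Ham_permMat, ovSq]
    congr 1; ring
  have hle : ∑ π : Equiv.Perm (Fin n), ∑ p, Real.exp (pairExp b (1 / 2) X (permMat π A) p) ≤
      Fintype.card (Equiv.Perm (Fin n)) * (ZX * ((2 * n + 1) * (n + 1)) * M) := by
    rw [Fintype.card_perm, Fintype.card_fin]
    simp only [hsum]
    rw [Finset.sum_comm, hM, Finset.mul_sum, Finset.mul_sum]
    refine Finset.sum_le_sum fun τ _ => ?_
    rw [← Finset.mul_sum]
    calc Real.exp (-b * Ham (natMat A) τ) * ∑ π : Equiv.Perm (Fin n), F (τ ∘ π)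
        ≤ Real.exp (-b * Ham (natMat A) τ) * (n.factorial * ((n + 1) * Real.exp (mag τ ^ 2 / n) *
          ((∑ σ, F σ) / 2 ^ n))) := by gcongr; exact sum_perm_le hn τ hFnn
      _ ≤ Real.exp (-b * Ham (natMat A) τ) * (n.factorial * ((n + 1) * Real.exp (mag τ ^ 2 / n) *
          ((2 * n + 1) * ZX))) := by gcongr
      _ = _ := by rw [Real.exp_add, one_mul]; ring
  have h := sum_log_le (fun π => sum_exp_pos (pairExp b (1 / 2) X (permMat π A)))
    (by positivity) hle
  rw [Real.log_mul (by positivity) hMpos.ne', Real.log_mul hZpos.ne' (by positivity),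
    Fintype.card_perm, Fintype.card_fin] at h
  have eX : magFree b 0 X = Real.log ZX := magFree_zero_eq_log_Zpart b X
  rw [eX]
  exact h

lemma integrable_pairFree_prod {n : ℕ} {b : ℝ} (hb : 0 ≤ b) (lam d d' : ℝ) :
    Integrable (fun w : NatMat n × NatMat n => pairFree b lam w.1 w.2)
      ((sparseMeasure n d).prod (sparseMeasure n d')) := by
  refine integrable_of_abs_le ((integrable_const |pairFree b lam (0 : NatMat n) 0|).add
    ((integrable_tot_prod n d d').const_mul b)) fun w => ?_
  have h := abs_pairFree_add_le hb lam 0 0 w.1 w.2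
  rwa [zero_add, zero_add] at h

lemma integral_pairFree_prod_le {n : ℕ} (hn : 0 < n) {b d : ℝ} (hb : 0 ≤ b) (hd : 0 ≤ d) :
    ∫ w : NatMat n × NatMat n, pairFree b (1 / 2) w.1 w.2
        ∂((sparseMeasure n d).prod (sparseMeasure n d)) ≤
      ∫ A : NatMat n, magFree b 0 A ∂(sparseMeasure n d) + Real.log ((2 * n + 1) * (n + 1)) +
        ∫ A : NatMat n, magFree b 1 A ∂(sparseMeasure n d) := by
  set P := (sparseMeasure n d).prod (sparseMeasure n d) with hP
  have hmp : ∀ π : Equiv.Perm (Fin n),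
      MeasurePreserving (Prod.map id (permMat π) : NatMat n × NatMat n → _) P P := fun π =>
    (MeasurePreserving.id _).prod (measurePreserving_permMat hd π)
  have h_integrable := integrable_pairFree_prod (n := n) hb (1 / 2) d d
  have hπint : ∀ π : Equiv.Perm (Fin n), Integrable (fun w : NatMat n × NatMat n =>
      pairFree b (1 / 2) w.1 (permMat π w.2)) P := fun π =>
    (hmp π).integrable_comp_of_integrable h_integrable
  have hπ : ∀ π : Equiv.Perm (Fin n), ∫ w : NatMat n × NatMat n,
      pairFree b (1 / 2) w.1 (permMat π w.2) ∂P =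
      ∫ w : NatMat n × NatMat n, pairFree b (1 / 2) w.1 w.2 ∂P := by
    intro π
    conv_rhs => rw [← (hmp π).map_eq]
    rw [integral_map (hmp π).measurable.aemeasurable
      Measurable.of_discrete.aestronglyMeasurable]
    rfl
  have i0 := (integrable_magFree (n := n) hb 0 d).comp_fst (sparseMeasure n d)
  have i1 := (integrable_magFree (n := n) hb 1 d).comp_snd (sparseMeasure n d)
  have ic : Integrable (fun w : NatMat n × NatMat n => magFree b 0 w.1 +
      Real.log ((2 * n + 1) * (n + 1))) P := i0.add (integrable_const _)
  have hfac : (0 : ℝ) < n.factorial := by positivity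
  refine le_of_mul_le_mul_left ?_ hfac
  calc (n.factorial : ℝ) * ∫ w : NatMat n × NatMat n, pairFree b (1 / 2) w.1 w.2 ∂P
      = ∑ π : Equiv.Perm (Fin n), ∫ w : NatMat n × NatMat n,
          pairFree b (1 / 2) w.1 (permMat π w.2) ∂P := by
        rw [Finset.sum_congr rfl fun π _ => hπ π, Finset.sum_const, Finset.card_univ,
          Fintype.card_perm, Fintype.card_fin, nsmul_eq_mul]
    _ = ∫ w : NatMat n × NatMat n, ∑ π : Equiv.Perm (Fin n),
          pairFree b (1 / 2) w.1 (permMat π w.2) ∂P :=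
        (integral_finsetSum _ fun π _ => hπint π).symm
    _ ≤ ∫ w : NatMat n × NatMat n, n.factorial * (magFree b 0 w.1 +
          Real.log ((2 * n + 1) * (n + 1)) + magFree b 1 w.2) ∂P :=
        integral_mono (integrable_finsetSum _ fun π _ => hπint π)
          ((ic.add i1).const_mul _)
          fun w => sum_pairFree_permMat_le hn b w.1 w.2
    _ = _ := by
        rw [integral_const_mul, integral_add ic i1,
          integral_add i0 (integrable_const _), hP,
          integral_fun_fst (fun A => magFree b 0 A), integral_fun_snd (fun A => magFree b 1 A)]
        simp

lemma sparseMeasure_rate_zero (n : ℕ) : sparseMeasure n 0 = Measure.dirac 0 := by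
  have h0 : (sparseMeasure n 0) {0} = 1 := by
    have h := sparseMeasure_singleton_zero n le_rfl
    simp only [zero_div, mul_zero, neg_zero, Real.exp_zero] at h
    rwa [measureReal_def, ENNReal.toReal_eq_one_iff] at h
  refine Measure.ext_of_singleton fun A => ?_
  by_cases hA : A = 0
  · rw [hA, h0]; simp
  · have h1 : (sparseMeasure n 0) {0}ᶜ = 0 := (prob_compl_eq_zero_iff (by measurability)).mpr h0
    rw [measure_mono_null (Set.singleton_subset_iff.mpr hA) h1]
    simp [Ne.symm hA]

lemma interpFree_zero_eq (n : ℕ) (b d lam : ℝ) :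
    interpFree n b d lam 0 = ∫ w : NatMat n × NatMat n, pairFree b lam w.1 w.2
        ∂((sparseMeasure n d).prod (sparseMeasure n d)) := by
  unfold interpFree coupledSparse
  simp only [sub_zero, sub_self, zero_mul, one_mul, mul_zero]
  rw [sparseMeasure_rate_zero, Measure.dirac_prod, integral_map
    Measurable.of_discrete.aemeasurable Measurable.of_discrete.aestronglyMeasurable]
  simp

lemma exp_neg_Ham_eq_prod {n : ℕ} (b : ℝ) (A : NatMat n) (σ : Conf n) :
    Real.exp (-b * Ham (natMat A) σ) =
      ∏ i, ∏ j, Real.exp (-b * (spin (σ i) * spin (σ j)) * A i j) := by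
  simp only [← Real.exp_sum]
  congr 1
  unfold Ham natMat
  simp only [Finset.mul_sum]
  refine Finset.sum_congr rfl fun i _ => Finset.sum_congr rfl fun j _ => ?_
  ring

lemma integrable_exp_neg_Ham {n : ℕ} (b d : ℝ) (σ : Conf n) :
    Integrable (fun A : NatMat n => Real.exp (-b * Ham (natMat A) σ)) (sparseMeasure n d) := by
  simp only [exp_neg_Ham_eq_prod]
  exact Integrable.fintype_prod fun i => Integrable.fintype_prod fun j =>
    integrable_exp_poissonMeasure _ _

lemma integral_exp_neg_Ham {n : ℕ} (b : ℝ) {d : ℝ} (hd : 0 ≤ d) (σ : Conf n) :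
    ∫ A : NatMat n, Real.exp (-b * Ham (natMat A) σ) ∂(sparseMeasure n d) =
      Real.exp (d / (2 * n) * ∑ i, ∑ j, (Real.exp (-b * (spin (σ i) * spin (σ j))) - 1)) := by
  simp only [exp_neg_Ham_eq_prod]
  unfold sparseMeasure
  rw [integral_fintype_prod_eq_prod (fun i (a : Fin n → ℕ) =>
    ∏ j, Real.exp (-b * (spin (σ i) * spin (σ j)) * a j))]
  simp only [Finset.mul_sum, Real.exp_sum]
  refine Finset.prod_congr rfl fun i _ => ?_
  rw [integral_fintype_prod_eq_prod (fun j (k : ℕ) =>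
    Real.exp (-b * (spin (σ i) * spin (σ j)) * k))]
  refine Finset.prod_congr rfl fun j _ => ?_
  rw [integral_exp_poissonMeasure, Real.coe_toNNReal _ (by positivity)]

lemma sum_sum_spin_mul {n : ℕ} (σ : Conf n) :
    ∑ i, ∑ j, spin (σ i) * spin (σ j) = mag σ ^ 2 := by
  rw [mag, sq, Finset.sum_mul_sum]

lemma exp_neg_spin_sub_one_le {b x : ℝ} (hb0 : 0 ≤ b) (hb : b ≤ 1) (hx : |x| = 1) :
    Real.exp (-b * x) - 1 ≤ -b * x + b ^ 2 := by
  have h1 : |-b * x| ≤ 1 := by rw [abs_mul, hx, mul_one, abs_neg, abs_of_nonneg hb0]; exact hb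
  have h := (abs_le.mp (Real.abs_exp_sub_one_sub_id_le h1)).2
  have h2 : (-b * x) ^ 2 = b ^ 2 := by rw [mul_pow, ← sq_abs x, hx]; ring
  linarith

lemma integral_exp_neg_Ham_le {n : ℕ} (hn : 0 < n) {b d : ℝ} (hb0 : 0 ≤ b) (hb : b ≤ 1)
    (hd : 0 ≤ d) (σ : Conf n) :
    ∫ A : NatMat n, Real.exp (-b * Ham (natMat A) σ) ∂(sparseMeasure n d) ≤
      Real.exp (n * d * b ^ 2 / 2 - b * d / 2 * (mag σ ^ 2 / n)) := by
  have hn' : (0 : ℝ) < n := by exact_mod_cast hn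
  rw [integral_exp_neg_Ham b hd]
  refine Real.exp_le_exp.mpr ?_
  have h : ∑ i, ∑ j, (Real.exp (-b * (spin (σ i) * spin (σ j))) - 1) ≤
      -b * mag σ ^ 2 + n ^ 2 * b ^ 2 := by
    calc ∑ i, ∑ j, (Real.exp (-b * (spin (σ i) * spin (σ j))) - 1)
        ≤ ∑ i, ∑ j, (-b * (spin (σ i) * spin (σ j)) + b ^ 2) := by
          refine Finset.sum_le_sum fun i _ => Finset.sum_le_sum fun j _ => ?_
          exact exp_neg_spin_sub_one_le hb0 hb (by rw [abs_mul, abs_spin, abs_spin, one_mul])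
      _ = _ := by
          rw [← sum_sum_spin_mul, Finset.mul_sum]
          simp only [Finset.sum_add_distrib, Finset.mul_sum]
          simp
          ring
  calc d / (2 * n) * ∑ i, ∑ j, (Real.exp (-b * (spin (σ i) * spin (σ j))) - 1)
      ≤ d / (2 * n) * (-b * mag σ ^ 2 + n ^ 2 * b ^ 2) := by gcongr
    _ = _ := by field_simp; ring

/-- The annealed upper bound, with the magnetization coupling that centers the disorder. -/
lemma integral_magFree_le {n : ℕ} (hn : 0 < n) {b d : ℝ} (hb0 : 0 ≤ b) (hb : b ≤ 1)
    (hd : 0 ≤ d) :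
    ∫ A : NatMat n, magFree b (b * d / 2) A ∂(sparseMeasure n d) ≤
      n * Real.log 2 + n * d * b ^ 2 / 2 := by
  have hi : ∀ σ : Conf n, Integrable (fun A : NatMat n => Real.exp (-b * Ham (natMat A) σ +
      b * d / 2 * (mag σ ^ 2 / n))) (sparseMeasure n d) := by
    intro σ
    simp only [Real.exp_add]
    exact (integrable_exp_neg_Ham b d σ).mul_const _
  have hle : ∀ σ : Conf n, ∫ A : NatMat n, Real.exp (-b * Ham (natMat A) σ +
      b * d / 2 * (mag σ ^ 2 / n)) ∂(sparseMeasure n d) ≤ Real.exp (n * d * b ^ 2 / 2) := by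
    intro σ
    simp only [Real.exp_add]
    rw [integral_mul_const]
    refine (mul_le_mul_of_nonneg_right (integral_exp_neg_Ham_le hn hb0 hb hd σ)
      (Real.exp_pos _).le).trans (le_of_eq ?_)
    rw [← Real.exp_add]; congr 1; ring
  have hc : Real.log (2 ^ n * Real.exp (n * d * b ^ 2 / 2)) =
      n * Real.log 2 + n * d * b ^ 2 / 2 := by
    rw [Real.log_mul (by positivity) (by positivity), Real.log_exp, Real.log_pow]
  rw [← hc]
  refine integral_log_le (sparseMeasure n d) (fun A => sum_exp_pos _) (by positivity)
    (integrable_finsetSum _ fun σ _ => hi σ) (integrable_magFree hb0 _ d) ?_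
  rw [integral_finsetSum _ fun σ _ => hi σ]
  refine (Finset.sum_le_card_nsmul _ _ _ fun σ _ => hle σ).trans (le_of_eq ?_)
  simp

lemma sum_spin_mul_spin {n : ℕ} {i j : Fin n} (hij : i ≠ j) :
    ∑ σ : Conf n, spin (σ i) * spin (σ j) = 0 := by
  refine Finset.sum_involution (fun σ _ => Function.update σ i (!σ i)) ?_ ?_ ?_ ?_
  · intro σ _
    rw [Function.update_self, Function.update_of_ne hij.symm]
    cases σ i <;> cases σ j <;> simp [spin]
  · intro σ _ _ h
    have := congrFun h i
    simp at this
  · simp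
  · intro σ _
    simp

lemma sum_Ham {n : ℕ} (A : NatMat n) :
    ∑ σ : Conf n, Ham (natMat A) σ = 2 ^ n * ∑ i, (A i i : ℝ) := by
  unfold Ham natMat
  rw [Finset.sum_comm, Finset.mul_sum]
  refine Finset.sum_congr rfl fun i _ => ?_
  rw [Finset.sum_comm, Finset.sum_eq_single i]
  · simp [mul_assoc, spin_sq]
  · intro j _ hj
    simp only [mul_assoc]
    rw [← Finset.mul_sum, sum_spin_mul_spin hj.symm, mul_zero]
  · simp

lemma magFree_zero_ge {n : ℕ} (b : ℝ) (A : NatMat n) :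
    n * Real.log 2 - b * ∑ i, (A i i : ℝ) ≤ magFree b 0 A := by
  have h := logSumExp_add_ge (fun _ : Conf n => (0 : ℝ)) (fun σ => -b * Ham (natMat A) σ)
  have e1 : logSumExp (fun _ : Conf n => (0 : ℝ)) = n * Real.log 2 := by
    simp [logSumExp, Real.log_pow]
  have e2 : expAvg (fun _ : Conf n => (0 : ℝ)) (fun σ => -b * Ham (natMat A) σ) =
      -b * ∑ i, (A i i : ℝ) := by
    rw [expAvg_const_mul]
    congr 1
    simp [expAvg, sum_Ham]
  rw [e1, e2] at h
  simp only [magFree, zero_mul, add_zero]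
  simp only [zero_add] at h
  linarith

lemma integral_magFree_zero_ge {n : ℕ} (hn : 0 < n) {b d : ℝ} (hb : 0 ≤ b) (hd : 0 ≤ d) :
    n * Real.log 2 - b * d / 2 ≤ ∫ A : NatMat n, magFree b 0 A ∂(sparseMeasure n d) := by
  have hn' : (0 : ℝ) < n := by exact_mod_cast hn
  have hi : Integrable (fun A : NatMat n => ∑ i, (A i i : ℝ)) (sparseMeasure n d) :=
    integrable_finsetSum _ fun i _ => integrable_entry n d i i
  refine le_trans (le_of_eq ?_) (integral_mono ((integrable_const _).sub (hi.const_mul b))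
    (integrable_magFree hb 0 d) fun A => magFree_zero_ge b A)
  simp only [Pi.sub_apply]
  rw [integral_sub (integrable_const _) (hi.const_mul b), integral_const_mul b,
    integral_finsetSum _ fun i _ => integrable_entry n d i i]
  simp only [integral_entry n hd]
  simp
  field_simp

lemma integral_magFree_one_le {n : ℕ} (hn : 0 < n) {b d : ℝ} (hb0 : 0 ≤ b) (hb : b ≤ 1)
    (hd : 0 ≤ d) (hU : 1 ≤ b * d / 2) :
    ∫ A : NatMat n, magFree b 1 A ∂(sparseMeasure n d) ≤
      ∫ A : NatMat n, magFree b 0 A ∂(sparseMeasure n d) + n * b + 1 := by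
  set U := b * d / 2 with hUd
  have i0 := integrable_magFree (n := n) hb0 0 d
  have i1 := integrable_magFree (n := n) hb0 1 d
  have iU := integrable_magFree (n := n) hb0 U d
  have hpt : ∀ A : NatMat n, U * (magFree b 1 A - magFree b 0 A) ≤
      magFree b U A - magFree b 0 A := by
    intro A
    have h := logSumExp_add_le_of_one_le (fun τ : Conf n => -b * Ham (natMat A) τ)
      (fun τ => mag τ ^ 2 / n) hU
    simpa only [magFree, one_mul, zero_mul, add_zero] using h
  have h := integral_mono ((i1.sub i0).const_mul U) (iU.sub i0) hpt
  simp only [Pi.sub_apply] at h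
  rw [integral_const_mul, integral_sub i1 i0, integral_sub iU i0] at h
  have h1 := integral_magFree_le hn hb0 hb hd
  have h2 := integral_magFree_zero_ge hn hb0 hd
  rw [← hUd] at h1 h2
  have h3 : U * (∫ A : NatMat n, magFree b 1 A ∂(sparseMeasure n d) -
      ∫ A : NatMat n, magFree b 0 A ∂(sparseMeasure n d)) ≤ U * (n * b + 1) := by
    have : n * d * b ^ 2 / 2 = U * (n * b) := by rw [hUd]; ring
    linarith
  have := le_of_mul_le_mul_left h3 (by linarith)
  linarith

lemma interpFree_zero_le {n : ℕ} (hn : 0 < n) {b d : ℝ} (hb0 : 0 ≤ b) (hb : b ≤ 1)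
    (hd : 0 ≤ d) (hU : 1 ≤ b * d / 2) :
    interpFree n b d (1 / 2) 0 ≤ 2 * ∫ A : NatMat n, magFree b 0 A ∂(sparseMeasure n d) +
      Real.log ((2 * n + 1) * (n + 1)) + n * b + 1 := by
  rw [interpFree_zero_eq]
  have h1 := integral_pairFree_prod_le hn hb0 hd
  have h2 := integral_magFree_one_le hn hb0 hb hd hU
  linarith

lemma pairFree_zero_coupling {n : ℕ} (b : ℝ) (X Y : NatMat n) :
    pairFree b 0 X Y = magFree b 0 X + magFree b 0 Y := by
  rw [magFree_zero_eq_log_Zpart, magFree_zero_eq_log_Zpart,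
    ← Real.log_mul (Zpart_pos _ _).ne' (Zpart_pos _ _).ne']
  unfold pairFree logSumExp Zpart
  rw [Fintype.sum_prod_type, Finset.sum_mul_sum]
  congr 1
  refine Finset.sum_congr rfl fun σ _ => Finset.sum_congr rfl fun τ _ => ?_
  rw [← Real.exp_add, pairExp]
  congr 1; ring

lemma pairOv_zero_coupling {n : ℕ} (b : ℝ) (X Y : NatMat n) :
    pairOv b 0 X Y = avg2c b (natMat X) (natMat Y) (fun σ1 σ2 => overlap σ1 σ2 ^ 2) := by
  have hZ : ∑ p, Real.exp (pairExp b 0 X Y p) = Zpart b (natMat X) * Zpart b (natMat Y) := by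
    unfold Zpart
    rw [Fintype.sum_prod_type, Finset.sum_mul_sum]
    refine Finset.sum_congr rfl fun σ _ => Finset.sum_congr rfl fun τ _ => ?_
    rw [← Real.exp_add, pairExp]
    congr 1; ring
  unfold pairOv expAvg avg2c gibbs
  rw [hZ, Fintype.sum_prod_type, Finset.sum_div]
  refine Finset.sum_congr rfl fun σ _ => ?_
  rw [Finset.sum_div]
  refine Finset.sum_congr rfl fun τ _ => ?_
  have h1 := (Zpart_pos b (natMat X)).ne'
  have h2 := (Zpart_pos b (natMat Y)).ne'
  have h3 : pairExp b 0 X Y (σ, τ) = -b * Ham (natMat X) σ + -b * Ham (natMat Y) τ := by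
    rw [pairExp]; ring
  rw [h3, ovSq, Real.exp_add]
  field_simp

lemma measurePreserving_marginals (n : ℕ) {d q : ℝ} (hd : 0 ≤ d) (hq0 : 0 ≤ q) (hq1 : q ≤ 1) :
    MeasurePreserving (fun w : NatMat n × NatMat n × NatMat n => w.1 + w.2.1)
      (coupledSparse n d (1 - q)) (sparseMeasure n d) ∧
    MeasurePreserving (fun w : NatMat n × NatMat n × NatMat n => w.1 + w.2.2)
      (coupledSparse n d (1 - q)) (sparseMeasure n d) := by
  have h := measurePreserving_add_sparse n (a := (1 - (1 - q)) * d) (b := (1 - q) * d)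
    (mul_nonneg (by linarith) hd) (mul_nonneg (by linarith) hd)
  rw [← add_mul, sub_add_cancel, one_mul] at h
  exact ⟨h.comp ((MeasurePreserving.id _).prod measurePreserving_fst),
    h.comp ((MeasurePreserving.id _).prod measurePreserving_snd)⟩

/-- The interpolating free energy controls the mean squared overlap. -/
lemma interpFree_ge {n : ℕ} {b d q : ℝ} (hb : 0 ≤ b) (hd : 0 ≤ d) (hq0 : 0 ≤ q)
    (hq1 : q ≤ 1) (hκ : Real.tanh b ^ 2 * d / 2 * q ≤ 1 / 4) :
    2 * ∫ A : NatMat n, magFree b 0 A ∂(sparseMeasure n d) + n / 4 * overlapMean n b d q ≤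
      interpFree n b d (1 / 2) q := by
  obtain ⟨m1, m2⟩ := measurePreserving_marginals n hd hq0 hq1
  have i0 := integrable_magFree (n := n) hb 0 d
  have j1 : Integrable (fun w : NatMat n × NatMat n × NatMat n => magFree b 0 (w.1 + w.2.1))
      (coupledSparse n d (1 - q)) := m1.integrable_comp_of_integrable i0
  have j2 : Integrable (fun w : NatMat n × NatMat n × NatMat n => magFree b 0 (w.1 + w.2.2))
      (coupledSparse n d (1 - q)) := m2.integrable_comp_of_integrable i0
  have j3 : Integrable (fun w : NatMat n × NatMat n × NatMat n =>
      pairOv b 0 (w.1 + w.2.1) (w.1 + w.2.2)) (coupledSparse n d (1 - q)) :=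
    integrable_of_bounded _ 1 fun w => by
      rw [abs_of_nonneg (pairOv_nonneg _ _ _ _)]; exact pairOv_le_one _ _ _ _
  have e1 : ∫ w : NatMat n × NatMat n × NatMat n, magFree b 0 (w.1 + w.2.1)
      ∂(coupledSparse n d (1 - q)) = ∫ A : NatMat n, magFree b 0 A ∂(sparseMeasure n d) := by
    rw [← m1.map_eq, integral_map m1.measurable.aemeasurable
      Measurable.of_discrete.aestronglyMeasurable]
  have e2 : ∫ w : NatMat n × NatMat n × NatMat n, magFree b 0 (w.1 + w.2.2)
      ∂(coupledSparse n d (1 - q)) = ∫ A : NatMat n, magFree b 0 A ∂(sparseMeasure n d) := by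
    rw [← m2.map_eq, integral_map m2.measurable.aemeasurable
      Measurable.of_discrete.aestronglyMeasurable]
  have e3 : ∫ w : NatMat n × NatMat n × NatMat n, pairOv b 0 (w.1 + w.2.1) (w.1 + w.2.2)
      ∂(coupledSparse n d (1 - q)) = overlapMean n b d q := by
    simp only [pairOv_zero_coupling]; rfl
  have hsum : Integrable (fun w : NatMat n × NatMat n × NatMat n =>
      magFree b 0 (w.1 + w.2.1) + magFree b 0 (w.1 + w.2.2)) (coupledSparse n d (1 - q)) :=
    j1.add j2
  have hpt : ∀ w : NatMat n × NatMat n × NatMat n,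
      magFree b 0 (w.1 + w.2.1) + magFree b 0 (w.1 + w.2.2) +
        n / 4 * pairOv b 0 (w.1 + w.2.1) (w.1 + w.2.2) ≤
      pairFree b (1 / 2 - Real.tanh b ^ 2 * d / 2 * q) (w.1 + w.2.1) (w.1 + w.2.2) := by
    intro w
    have h := pairFree_coupling_ge b 0 (1 / 2 - Real.tanh b ^ 2 * d / 2 * q) (w.1 + w.2.1)
      (w.1 + w.2.2)
    rw [zero_add, pairFree_zero_coupling] at h
    have hnn : 0 ≤ (n : ℝ) * pairOv b 0 (w.1 + w.2.1) (w.1 + w.2.2) :=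
      mul_nonneg n.cast_nonneg (pairOv_nonneg _ _ _ _)
    nlinarith
  have h := integral_mono (hsum.add (j3.const_mul (n / 4)))
    (integrable_pairFree_coupledSparse hb d (1 / 2 - Real.tanh b ^ 2 * d / 2 * q) (1 - q)) hpt
  refine le_trans (le_of_eq ?_) h
  simp only [Pi.add_apply]
  rw [integral_add hsum (j3.const_mul _), integral_add j1 j2, integral_const_mul, e1, e2, e3]
  ring

/-- Quantitative decorrelation when only a small fraction `q` of the disorder is shared. -/
lemma overlapMean_le {n : ℕ} (hn : 0 < n) {b d q : ℝ} (hb0 : 0 ≤ b) (hb : b ≤ 1 / 4)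
    (hd : 0 ≤ d) (hU : 1 ≤ b * d / 2) (hq0 : 0 ≤ q) (hq1 : q ≤ 1) (hq : 8 * (b ^ 2 * d) * q ≤ 1) :
    overlapMean n b d q ≤
      4 * (Real.log ((2 * n + 1) * (n + 1)) + 1) / n + (4 + 320 * (b ^ 2 * d)) * b := by
  have hn' : (0 : ℝ) < n := by exact_mod_cast hn
  have hT0 := tanh_nonneg_of_nonneg hb0
  have hT := tanh_le_two_mul hb0
  have hT2 : Real.tanh b ^ 2 ≤ 4 * b ^ 2 := by nlinarith
  have hT3 : Real.tanh b ^ 3 ≤ 8 * b ^ 3 :=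
    (pow_le_pow_left₀ hT0 hT 3).trans (le_of_eq (by ring))
  have hκ : Real.tanh b ^ 2 * d / 2 * q ≤ 1 / 4 := by
    have : Real.tanh b ^ 2 * (d * q) ≤ 4 * b ^ 2 * (d * q) := by gcongr
    linarith
  have h1 := interpFree_ge (n := n) hb0 hd hq0 hq1 hκ
  have h2 := interpFree_le hn hb0 hd (by linarith) (1 / 2) hq0 hq1
  have h3 := interpFree_zero_le hn hb0 (by linarith) hd hU
  have h4 : q * (10 * Real.tanh b ^ 3 * d * n) ≤ 80 * (b ^ 2 * d) * b * n := by
    calc q * (10 * Real.tanh b ^ 3 * d * n) ≤ 1 * (10 * (8 * b ^ 3) * d * n) := by gcongr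
      _ = _ := by ring
  have h5 : n / 4 * overlapMean n b d q ≤ Real.log ((2 * n + 1) * (n + 1)) + 1 + n * b +
      80 * (b ^ 2 * d) * b * n := by linarith
  have h6 : overlapMean n b d q = n / 4 * overlapMean n b d q * (4 / n) := by field_simp
  rw [h6]
  refine (mul_le_mul_of_nonneg_right h5 (by positivity)).trans (le_of_eq ?_)
  field_simp
  ring

lemma twoPoint_zero_temp {n : ℕ} {i j : Fin n} (A : NatMat n) :
    twoPoint 0 i j A = if i = j then 1 else 0 := by
  split_ifs with hij
  · subst hij
    simp [twoPoint, avg1, spin_sq, sum_gibbs]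
  · have h := sum_spin_mul_spin hij
    simp [twoPoint, avg1, gibbs, ← Finset.sum_mul, h]

lemma overlapMean_zero_temp (n : ℕ) (d q : ℝ) : overlapMean n 0 d q = 1 / n := by
  unfold overlapMean
  simp only [avg2c_overlap_sq, twoPoint_zero_temp]
  rcases Nat.eq_zero_or_pos n with rfl | hn
  · simp
  · have hn' : (n : ℝ) ≠ 0 := by positivity
    simp
    field_simp

lemma tendsto_log_correction :
    Tendsto (fun n : ℕ => 4 * (Real.log ((2 * n + 1) * (n + 1)) + 1) / (n : ℝ)) atTop (nhds 0) := by
  have h1 : Tendsto (fun n : ℕ => 8 * (Real.log n ^ 1 / (1 * (n : ℝ) + 0)) +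
      4 * (Real.log 6 + 1) * (n : ℝ)⁻¹) atTop (nhds (8 * 0 + 4 * (Real.log 6 + 1) * 0)) :=
    (((Real.tendsto_pow_log_div_mul_add_atTop 1 0 1 one_ne_zero).comp
      tendsto_natCast_atTop_atTop).const_mul 8).add
      (tendsto_inv_atTop_nhds_zero_nat.const_mul _)
  simp only [mul_zero, add_zero, pow_one, one_mul] at h1
  refine squeeze_zero' ?_ ?_ h1
  · refine Eventually.of_forall fun n => ?_
    have h : (1 : ℝ) ≤ (2 * n + 1) * (n + 1) := by
      have : (0 : ℝ) ≤ n := n.cast_nonneg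
      nlinarith
    have := Real.log_nonneg h
    positivity
  · filter_upwards [eventually_ge_atTop 1] with n hn
    have hn' : (1 : ℝ) ≤ n := by exact_mod_cast hn
    have h : Real.log ((2 * n + 1) * (n + 1)) ≤ Real.log 6 + 2 * Real.log n := by
      calc Real.log ((2 * n + 1) * (n + 1)) ≤ Real.log (6 * (n : ℝ) ^ 2) :=
            Real.log_le_log (by positivity) (by nlinarith)
        _ = _ := by
            rw [Real.log_mul (by norm_num) (by positivity), Real.log_pow]; push_cast; ring
    calc 4 * (Real.log ((2 * n + 1) * (n + 1)) + 1) / (n : ℝ)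
        ≤ 4 * (Real.log 6 + 2 * Real.log n + 1) / (n : ℝ) := by gcongr
      _ = _ := by field_simp; ring

lemma limsup_overlapMean_le {t d b : ℝ} {k : ℕ} (ht0 : 0 ≤ t) (ht1 : t ≤ 1)
    (hb0 : 0 ≤ b) (hb : b ≤ 1 / 4) (hd : 0 ≤ d) (hU : 1 ≤ b * d / 2)
    (hq : 8 * (b ^ 2 * d) * (1 - t) ^ 2 ^ k ≤ 1) :
    limsup (fun n : ℕ => overlapMean n b d (1 - t)) atTop ≤
      ((4 + 320 * (b ^ 2 * d)) * b) ^ ((1 / 2 : ℝ) ^ k) := by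
  have hp : 0 < (1 / 2 : ℝ) ^ k := by positivity
  have hlim : Tendsto (fun n : ℕ => (4 * (Real.log ((2 * n + 1) * (n + 1)) + 1) / (n : ℝ) +
      (4 + 320 * (b ^ 2 * d)) * b) ^ ((1 / 2 : ℝ) ^ k)) atTop
      (nhds ((0 + (4 + 320 * (b ^ 2 * d)) * b) ^ ((1 / 2 : ℝ) ^ k))) :=
    (tendsto_log_correction.add_const _).rpow_const (Or.inr hp.le)
  rw [zero_add] at hlim
  rw [← hlim.limsup_eq]
  refine limsup_le_limsup ?_ ?_ hlim.isBoundedUnder_le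
  · filter_upwards [eventually_gt_atTop 0] with n hn
    have hq0 : 0 ≤ 1 - t := by linarith
    refine (overlapMean_le_rpow n b hd hq0 (by linarith) k).trans ?_
    exact Real.rpow_le_rpow (overlapMean_nonneg _ _ _ _) (overlapMean_le hn hb0 hb hd hU
      (by positivity) (pow_le_one₀ hq0 (by linarith)) hq) hp.le
  · exact IsCoboundedUnder.of_frequently_ge (a := 0)
      (Frequently.of_forall fun n => overlapMean_nonneg n b d (1 - t))

lemma abs_overlapMean_le_one (n : ℕ) (b d q : ℝ) : |overlapMean n b d q| ≤ 1 := by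
  unfold overlapMean
  simp only [← pairOv_zero_coupling]
  refine abs_integral_le_of_bounded _ 1 fun w => ?_
  rw [abs_of_nonneg (pairOv_nonneg _ _ _ _)]
  exact pairOv_le_one _ _ _ _

lemma limsup_overlapMean_nonneg (b d q : ℝ) :
    0 ≤ limsup (fun n : ℕ => overlapMean n b d q) atTop :=
  le_limsup_of_frequently_le (Frequently.of_forall fun n => overlapMean_nonneg n b d q)
    (isBoundedUnder_of ⟨1, fun n => (abs_le.mp (abs_overlapMean_le_one n b d q)).2⟩)

lemma exists_pow_two_pow_le {q c : ℝ} (hq0 : 0 ≤ q) (hq1 : q < 1) (hc : 0 < c) :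
    ∃ k : ℕ, q ^ 2 ^ k ≤ c := by
  obtain ⟨k, hk⟩ := exists_pow_lt_of_lt_one hc hq1
  exact ⟨k, (pow_le_pow_of_le_one hq0 hq1.le Nat.lt_two_pow_self.le).trans hk.le⟩

lemma tendsto_limsup_overlapMean {t : ℝ} (ht0 : 0 < t) (ht1 : t ≤ 1) {β : ℝ} (hβ : 0 ≤ β) :
    Tendsto (fun d : ℝ => limsup (fun n : ℕ => overlapMean n (β / Real.sqrt d) d (1 - t)) atTop)
      atTop (nhds 0) := by
  rcases hβ.eq_or_lt with rfl | hβ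
  · simp only [zero_div, overlapMean_zero_temp]
    rw [tendsto_one_div_atTop_nhds_zero_nat.limsup_eq]
    exact tendsto_const_nhds
  obtain ⟨k, hk⟩ := exists_pow_two_pow_le (q := 1 - t) (c := 1 / (8 * β ^ 2)) (by linarith)
    (by linarith) (by positivity)
  have hp : 0 < (1 / 2 : ℝ) ^ k := by positivity
  have hb : Tendsto (fun d : ℝ => β / Real.sqrt d) atTop (nhds 0) :=
    Real.tendsto_sqrt_atTop.const_div_atTop β
  have hlim : Tendsto (fun d : ℝ => ((4 + 320 * β ^ 2) * (β / Real.sqrt d)) ^ ((1 / 2 : ℝ) ^ k))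
      atTop (nhds 0) := by
    have h := (hb.const_mul (4 + 320 * β ^ 2)).rpow_const (p := (1 / 2 : ℝ) ^ k) (Or.inr hp.le)
    rwa [mul_zero, Real.zero_rpow hp.ne'] at h
  refine squeeze_zero' (Eventually.of_forall fun d => limsup_overlapMean_nonneg _ _ _) ?_ hlim
  filter_upwards [eventually_gt_atTop 0, hb.eventually (eventually_le_nhds (by norm_num :
    (0 : ℝ) < 1 / 4)), Real.tendsto_sqrt_atTop.eventually_ge_atTop (2 / β)] with d hd hbd hsd
  have hs : 0 < Real.sqrt d := Real.sqrt_pos.mpr hd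
  have hsq : Real.sqrt d ^ 2 = d := Real.sq_sqrt hd.le
  have e1 : (β / Real.sqrt d) ^ 2 * d = β ^ 2 := by
    rw [div_pow, hsq]; field_simp
  have e2 : β / Real.sqrt d * d / 2 = β * Real.sqrt d / 2 := by
    nth_rewrite 2 [← hsq]; field_simp
  have hU : 1 ≤ β / Real.sqrt d * d / 2 := by
    rw [e2]
    have := (div_le_iff₀ hβ).mp hsd
    linarith
  have h := limsup_overlapMean_le (k := k) ht0.le ht1 (by positivity) hbd hd.le hU (by
    rw [e1]
    have := (le_div_iff₀ (by positivity)).mp hk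
    linarith)
  rwa [e1] at h

/-- disorder chaos for the sparse model: the coupled squared
overlap vanishes for any fixed perturbation `t > 0`. -/
theorem stmt_6 (t : ℝ) (ht0 : 0 < t) (ht1 : t ≤ 1) (β : ℝ) (hβ : 0 ≤ β) :
    Tendsto (fun d : ℝ =>
      limsup (fun n : ℕ =>
        ∫ w, avg2c (β / Real.sqrt d) (natMat (w.1 + w.2.1)) (natMat (w.1 + w.2.2))
          (fun σ1 σ2 => (overlap σ1 σ2) ^ 2) ∂(coupledSparse n d t)) atTop)
      atTop (nhds 0) := by
  have h := tendsto_limsup_overlapMean ht0 ht1 hβ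
  simpa only [overlapMean, sub_sub_cancel] using h
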